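/- arXiv:2004.03724 — 2 statements merged into one kernel-verified Lean document; each statement's English description precedes it below -/
import Mathlib

section
/- Let q ≥ 3 and p ≥ q be integers, s ∈ ℕ and Y_s ∈ 𝕐_s. For every sequence {ε_n}_{n=1}^∞ of positive numbers tending to infinity, there exists a function f ∈ Δ^(q)(Y_s) ∩ W^p such that limsup_{n→∞} ε_n · n^{p−q+2} · E_n^(q)(f, Y_s) = ∞. -/
noncomputable section

/-- A collection `Y_s ∈ 𝕐_s`: points `y 1 > y 2 > ⋯ > y (2s)` (decreasing in the index),
with the convention `y 0 = y (2s) + 2π`. -/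
structure PtsColl (s : ℕ) where
  y : ℕ → ℝ
  lt : ∀ i : ℕ, 1 ≤ i → i ≤ 2 * s → y i < y (i - 1)
  per : y 0 = y (2 * s) + 2 * Real.pi

/-- `f` is `q`-monotone (for `q ≥ 3`) on `[a,b]`: `f` is continuous on `[a,b]`,
`(q-2)`-times continuously differentiable on `(a,b)`, and `f^{(q-2)}` is convex on `(a,b)`. -/
def QMonotoneOn (q : ℕ) (f : ℝ → ℝ) (a b : ℝ) : Prop :=
  ContinuousOn f (Set.Icc a b) ∧
  ContDiffOn ℝ (q - 2 : ℕ) f (Set.Ioo a b) ∧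
  ConvexOn ℝ (Set.Ioo a b) (iteratedDerivWithin (q - 2) f (Set.Ioo a b))

/-- `f ∈ Δ^(q)(Y_s)`: `f` is continuous, `2π`-periodic, and `(-1)^(i-1) f` is `q`-monotone
on `[y i, y (i-1)]` for each `i = 1, …, 2s`. -/
def DeltaQ (q s : ℕ) (Y : PtsColl s) (f : ℝ → ℝ) : Prop :=
  Continuous f ∧ (∀ x : ℝ, f (x + 2 * Real.pi) = f x) ∧
  ∀ i : ℕ, 1 ≤ i → i ≤ 2 * s →
    QMonotoneOn q (fun x => (-1 : ℝ) ^ (i - 1) * f x) (Y.y i) (Y.y (i - 1))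

/-- `T ∈ 𝒯_n`: a real trigonometric polynomial of degree at most `n`. -/
def IsTrigPoly (n : ℕ) (T : ℝ → ℝ) : Prop :=
  ∃ a b : ℕ → ℝ, ∀ t : ℝ,
    T t = a 0 + ∑ k ∈ Finset.Icc 1 n, (a k * Real.cos (k * t) + b k * Real.sin (k * t))

/-- `f ∈ W^r`: `f` is `2π`-periodic, of class `C^{r-1}`, `f^{(r-1)}` is absolutely continuous
(being the integral of a locally integrable function `g = f^{(r)}`), and `esssup |f^{(r)}| ≤ 2`. -/
def SobolevW (r : ℕ) (f : ℝ → ℝ) : Prop :=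
  (∀ x : ℝ, f (x + 2 * Real.pi) = f x) ∧
  ContDiff ℝ (r - 1 : ℕ) f ∧
  ∃ g : ℝ → ℝ,
    (∀ a b : ℝ, IntervalIntegrable g MeasureTheory.volume a b) ∧
    (∀ᵐ x ∂MeasureTheory.volume, |g x| ≤ 2) ∧
    ∀ x : ℝ, iteratedDeriv (r - 1) f x =
      iteratedDeriv (r - 1) f 0 + ∫ t in (0 : ℝ)..x, g t

/-- `E_n^(q)(f, Y_s)`: the error of the best co-`q`-monotone approximation of `f`
by trigonometric polynomials of degree at most `n` belonging to `Δ^(q)(Y_s)`. -/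
def ErrCoQ (q n s : ℕ) (Y : PtsColl s) (f : ℝ → ℝ) : ℝ :=
  sInf ((fun T => ⨆ x : ℝ, |f x - T x|) '' {T : ℝ → ℝ | IsTrigPoly n T ∧ DeltaQ q s Y T})

open Polynomial in
lemma norm_coeff_mul_two_pi_le (p : ℂ[X]) (k : ℕ) :
    ‖p.coeff k‖ * (2 * Real.pi) ≤
      ∫ x in (-Real.pi)..Real.pi, ‖p.eval (Complex.exp (x * Complex.I))‖ := by
  have key : ∫ x in (-Real.pi)..Real.pi,
      Complex.exp (-(k * (x * Complex.I))) * p.eval (Complex.exp (x * Complex.I))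
        = p.coeff k * (2 * Real.pi) := by
    have h1 : ∀ x : ℝ, Complex.exp (-(k * (x * Complex.I))) * p.eval (Complex.exp (x * Complex.I))
        = ∑ j ∈ Finset.range (p.natDegree + 1),
          p.coeff j * Complex.exp ((((j : ℂ) - k) * Complex.I) * x) := by
      intro x
      rw [Polynomial.eval_eq_sum_range, Finset.mul_sum]
      refine Finset.sum_congr rfl fun j _ => ?_
      rw [← Complex.exp_nat_mul, mul_left_comm, ← Complex.exp_add]
      congr 2
      ring
    simp_rw [h1]
    rw [intervalIntegral.integral_finsetSum]
    swap
    · intro j _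
      exact (by fun_prop : Continuous _).intervalIntegrable _ _
    have h2 : ∀ j : ℕ, ∫ x in (-Real.pi)..Real.pi,
        p.coeff j * Complex.exp ((((j : ℂ) - k) * Complex.I) * x)
        = if j = k then p.coeff k * (2 * Real.pi) else 0 := by
      intro j
      rw [intervalIntegral.integral_const_mul]
      split_ifs with h
      · subst h
        simp
        left; ring
      · have hc : (((j : ℂ) - k) * Complex.I) ≠ 0 :=
          mul_ne_zero (sub_ne_zero.mpr (by exact_mod_cast h)) Complex.I_ne_zero
        rw [integral_exp_mul_complex hc]
        have : Complex.exp (((j : ℂ) - k) * Complex.I * (Real.pi : ℝ)) =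
            Complex.exp (((j : ℂ) - k) * Complex.I * ((-Real.pi : ℝ) : ℝ)) := by
          rw [Complex.exp_eq_exp_iff_exists_int]
          refine ⟨(j : ℤ) - k, ?_⟩
          push_cast
          ring
        rw [this]
        simp
    simp_rw [h2]
    rw [Finset.sum_ite_eq']
    split_ifs with h
    · rfl
    · have : p.coeff k = 0 := Polynomial.coeff_eq_zero_of_natDegree_lt (by
        simpa using h)
      simp [this]
  have h3 := intervalIntegral.norm_integral_le_integral_norm (μ := MeasureTheory.volume)
    (f := fun x : ℝ => Complex.exp (-(k * (x * Complex.I))) *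
      p.eval (Complex.exp (x * Complex.I)))
    (show -Real.pi ≤ Real.pi by linarith [Real.pi_pos])
  rw [key] at h3
  have h4 : ∀ x : ℝ, ‖Complex.exp (-(k * (x * Complex.I))) *
      p.eval (Complex.exp (x * Complex.I))‖ = ‖p.eval (Complex.exp (x * Complex.I))‖ := by
    intro x
    rw [norm_mul, Complex.norm_exp]
    simp
  simp_rw [h4] at h3
  simpa [abs_of_pos Real.pi_pos] using h3

open Polynomial in
/-- A Nikolskii-type inequality for polynomials on the unit circle. -/
lemma norm_eval_exp_le_integral (p : ℂ[X]) {d : ℕ} (hp : p.natDegree ≤ d) (x : ℝ) :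
    ‖p.eval (Complex.exp (x * Complex.I))‖ * (2 * Real.pi) ≤
      (d + 1) * ∫ x in (-Real.pi)..Real.pi, ‖p.eval (Complex.exp (x * Complex.I))‖ := by
  rw [Polynomial.eval_eq_sum_range' (Nat.lt_succ_of_le hp)]
  have h1 := norm_sum_le (Finset.range (d + 1))
    (fun i => p.coeff i * Complex.exp (x * Complex.I) ^ i)
  refine (mul_le_mul_of_nonneg_right h1 (by positivity)).trans ?_
  rw [Finset.sum_mul]
  refine (Finset.sum_le_sum (g := fun _ => ∫ x in (-Real.pi)..Real.pi,
    ‖p.eval (Complex.exp (x * Complex.I))‖) fun i _ => ?_).trans ?_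
  · rw [norm_mul, norm_pow, Complex.norm_exp_ofReal_mul_I, one_pow, mul_one]
    exact norm_coeff_mul_two_pi_le p i
  · simp

open Polynomial in
lemma IsTrigPoly.exists_polynomial {n : ℕ} {T : ℝ → ℝ} (hT : IsTrigPoly n T) :
    ∃ p : ℂ[X], p.natDegree ≤ 2 * n ∧
      ∀ t : ℝ, p.eval (Complex.exp (t * Complex.I)) =
        Complex.exp (n * (t * Complex.I)) * (T t : ℂ) := by
  obtain ⟨a, b, h⟩ := hT
  refine ⟨C (a 0 : ℂ) * X ^ n + ∑ k ∈ Finset.Icc 1 n,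
    (C (((a k : ℂ) - b k * Complex.I) / 2) * X ^ (n + k)
      + C (((a k : ℂ) + b k * Complex.I) / 2) * X ^ (n - k)), ?_, fun t => ?_⟩
  · refine (natDegree_add_le _ _).trans (max_le ?_ ?_)
    · exact (natDegree_C_mul_X_pow_le _ _).trans (by omega)
    · refine natDegree_sum_le_of_forall_le _ _ fun k hk => ?_
      rw [Finset.mem_Icc] at hk
      refine (natDegree_add_le _ _).trans (max_le ?_ ?_)
      · exact (natDegree_C_mul_X_pow_le _ _).trans (by omega)
      · exact (natDegree_C_mul_X_pow_le _ _).trans (by omega)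
  · rw [h t]
    simp only [eval_add, eval_mul, eval_C, eval_pow, eval_X, eval_finsetSum,
      ← Complex.exp_nat_mul]
    push_cast
    rw [mul_add, Finset.mul_sum, mul_comm (a 0 : ℂ)]
    congr 1
    refine Finset.sum_congr rfl fun k hk => ?_
    rw [Finset.mem_Icc] at hk
    rw [Complex.cos, Complex.sin]
    have e1 : Complex.exp (((n + k : ℕ) : ℂ) * (t * Complex.I)) =
        Complex.exp (n * (t * Complex.I)) * Complex.exp (k * t * Complex.I) := by
      rw [← Complex.exp_add]; congr 1; push_cast; ring
    have e2 : Complex.exp (((n - k : ℕ) : ℂ) * (t * Complex.I)) =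
        Complex.exp (n * (t * Complex.I)) * Complex.exp (-(k * t) * Complex.I) := by
      rw [← Complex.exp_add]; congr 1; rw [Nat.cast_sub hk.2]; ring
    push_cast at e1
    rw [e1, e2]
    linear_combination (0 : ℂ) * Complex.I_sq

lemma IsTrigPoly.contDiff {n : ℕ} {T : ℝ → ℝ} (hT : IsTrigPoly n T) {m : WithTop ℕ∞} :
    ContDiff ℝ m T := by
  obtain ⟨a, b, h⟩ := hT
  rw [show T = _ from funext h]
  refine contDiff_const.add (ContDiff.sum fun k _ => ?_)
  exact (contDiff_const.mul (Real.contDiff_cos.comp (contDiff_const.mul contDiff_id))).add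
    (contDiff_const.mul (Real.contDiff_sin.comp (contDiff_const.mul contDiff_id)))

lemma IsTrigPoly.deriv {n : ℕ} {T : ℝ → ℝ} (hT : IsTrigPoly n T) : IsTrigPoly n (deriv T) := by
  obtain ⟨a, b, h⟩ := hT
  refine ⟨fun k => k * b k, fun k => -(k * a k), fun t => ?_⟩
  rw [show T = _ from funext h]
  have : HasDerivAt (fun t : ℝ => a 0 + ∑ k ∈ Finset.Icc 1 n,
      (a k * Real.cos (k * t) + b k * Real.sin (k * t)))
      (0 + ∑ k ∈ Finset.Icc 1 n,
        (a k * (-Real.sin (k * t) * (k * 1)) + b k * (Real.cos (k * t) * (k * 1)))) t := by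
    refine (hasDerivAt_const _ _).add (HasDerivAt.fun_sum fun k _ => ?_)
    exact (((hasDerivAt_id t).const_mul (k : ℝ)).cos.const_mul _).add
      (((hasDerivAt_id t).const_mul (k : ℝ)).sin.const_mul _)
  rw [this.deriv]
  simp only [Nat.cast_zero, zero_mul]
  congr 1
  exact Finset.sum_congr rfl fun k _ => by ring

lemma IsTrigPoly.iteratedDeriv {n : ℕ} {T : ℝ → ℝ} (hT : IsTrigPoly n T) (j : ℕ) :
    IsTrigPoly n (iteratedDeriv j T) := by
  induction j with
  | zero => simpa using hT
  | succ j ih => rw [iteratedDeriv_succ]; exact ih.deriv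

open Polynomial in
/-- A crude Bernstein inequality. -/
lemma IsTrigPoly.abs_deriv_le {n : ℕ} {T : ℝ → ℝ} (hT : IsTrigPoly n T) {B : ℝ}
    (hB : ∀ t, |T t| ≤ B) (t : ℝ) : |_root_.deriv T t| ≤ 7 * (n : ℝ) ^ 2 * B := by
  obtain ⟨p, hp, h⟩ := hT.exists_polynomial
  have hB0 : 0 ≤ B := (abs_nonneg _).trans (hB 0)
  have hnorm : ∀ t : ℝ, ‖p.eval (Complex.exp (t * Complex.I))‖ = |T t| := fun t => by
    rw [h t, norm_mul, Complex.norm_exp]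
    simp
  have hcoeff : ∀ k, ‖p.coeff k‖ ≤ B := fun k => by
    have h1 := norm_coeff_mul_two_pi_le p k
    simp_rw [hnorm] at h1
    have h2 : ∫ x in (-Real.pi)..Real.pi, |T x| ≤ ∫ x in (-Real.pi)..Real.pi, B :=
      intervalIntegral.integral_mono_on (by linarith [Real.pi_pos])
        ((hT.contDiff (m := 0)).continuous.abs.intervalIntegrable _ _)
        (by simp) fun x _ => hB x
    rw [intervalIntegral.integral_const, smul_eq_mul] at h2
    nlinarith [Real.pi_pos]
  have hexp : HasDerivAt (fun t : ℝ => Complex.exp (t * Complex.I))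
      (Complex.exp (t * Complex.I) * Complex.I) t := by
    have := ((Complex.ofRealCLM.hasDerivAt (x := t)).mul_const Complex.I).cexp
    simpa using this
  have hexpn : HasDerivAt (fun t : ℝ => Complex.exp (n * (t * Complex.I)))
      (Complex.exp (n * (t * Complex.I)) * (n * Complex.I)) t := by
    have := (((Complex.ofRealCLM.hasDerivAt (x := t)).mul_const Complex.I).const_mul
      (n : ℂ)).cexp
    simpa using this
  have hTd : HasDerivAt T (_root_.deriv T t) t :=
    ((hT.contDiff (m := 1)).differentiable (by simp) t).hasDerivAt
  have d1 := (p.hasDerivAt (Complex.exp (t * Complex.I))).comp t hexp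
  have d2 := hexpn.mul hTd.ofReal_comp
  have heq : (fun x => Polynomial.eval x p) ∘ (fun t : ℝ => Complex.exp (t * Complex.I)) =
      (fun t : ℝ => Complex.exp (n * (t * Complex.I))) * fun t : ℝ => (T t : ℂ) := by
    funext t; simpa using h t
  rw [heq] at d1
  have e := d1.unique d2
  have hder : ‖p.derivative.eval (Complex.exp (t * Complex.I))‖ ≤ 4 * (n : ℝ) ^ 2 * B := by
    rcases Nat.eq_zero_or_pos n with rfl | hn
    · rw [derivative_of_natDegree_zero (by omega)]; simp
    have hd : p.derivative.natDegree < 2 * n :=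
      lt_of_le_of_lt (natDegree_derivative_le p) (by omega)
    rw [Polynomial.eval_eq_sum_range' hd]
    refine (norm_sum_le _ _).trans ((Finset.sum_le_sum (g := fun _ => 2 * (n : ℝ) * B)
      fun i hi => ?_).trans ?_)
    · rw [norm_mul, norm_pow, Complex.norm_exp_ofReal_mul_I, one_pow, mul_one,
        coeff_derivative, norm_mul, mul_comm]
      have : ‖((i : ℂ) + 1)‖ ≤ 2 * n := by
        have h3 : ((i : ℂ) + 1) = ((i + 1 : ℕ) : ℂ) := by push_cast; ring
        rw [h3, Complex.norm_natCast]
        have := Finset.mem_range.mp hi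
        exact_mod_cast (by omega : i + 1 ≤ 2 * n)
      exact mul_le_mul this (hcoeff _) (norm_nonneg _) (by positivity)
    · simp; ring_nf; rfl
  have e' : Complex.exp (n * (t * Complex.I)) * ((_root_.deriv T t : ℝ) : ℂ) =
      p.derivative.eval (Complex.exp (t * Complex.I)) *
        (Complex.exp (t * Complex.I) * Complex.I)
      - Complex.exp (n * (t * Complex.I)) * (n * Complex.I) * (T t : ℂ) := by
    rw [e]; ring
  have hn1 : ∀ m : ℕ, ‖Complex.exp (m * (t * Complex.I))‖ = 1 := fun m => by
    rw [Complex.norm_exp]; simp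
  have e2 := congrArg norm e'
  rw [norm_mul, hn1, one_mul, Complex.norm_real, Real.norm_eq_abs] at e2
  rw [e2]
  refine (norm_sub_le _ _).trans ?_
  rw [norm_mul, norm_mul, norm_mul, norm_mul, hn1, Complex.norm_exp_ofReal_mul_I]
  simp only [Complex.norm_I, mul_one, one_mul, norm_mul, Complex.norm_natCast, Complex.norm_real,
    Real.norm_eq_abs]
  have h5 : (n : ℝ) * |T t| ≤ (n : ℝ) ^ 2 * B := by
    refine mul_le_mul ?_ (hB t) (abs_nonneg _) (by positivity)
    exact_mod_cast Nat.le_self_pow (by norm_num) n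
  nlinarith [mul_nonneg (sq_nonneg (n : ℝ)) hB0]

lemma IsTrigPoly.abs_iteratedDeriv_le {n : ℕ} {T : ℝ → ℝ} (hT : IsTrigPoly n T) {B : ℝ}
    (hB : ∀ t, |T t| ≤ B) (j : ℕ) (t : ℝ) :
    |_root_.iteratedDeriv j T t| ≤ (7 * (n : ℝ) ^ 2) ^ j * B := by
  induction j generalizing t with
  | zero => simpa using hB t
  | succ j ih =>
    rw [iteratedDeriv_succ, pow_succ', mul_assoc]
    exact (hT.iteratedDeriv j).abs_deriv_le ih t

open Polynomial in
lemma IsTrigPoly.mul_cos_pow_le_integral {n : ℕ} {P : ℝ → ℝ} (hP : IsTrigPoly n P) (y x : ℝ) :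
    |P (y + x)| * (Real.cos (x / 2) ^ 2) ^ n * (2 * Real.pi) ≤
      (4 * n + 1) * ∫ u in (-Real.pi)..Real.pi, |P (y + u)| * (Real.cos (u / 2) ^ 2) ^ n := by
  obtain ⟨p, hp, h⟩ := hP.exists_polynomial
  set Q : ℂ[X] := p.comp (C (Complex.exp (y * Complex.I)) * X) *
    (C (1 / 2 : ℂ) * (X + 1)) ^ (2 * n) with hQ
  have hdeg : Q.natDegree ≤ 4 * n := by
    have h1 : (p.comp (C (Complex.exp (y * Complex.I)) * X)).natDegree ≤ 2 * n := by
      rw [natDegree_comp]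
      have := natDegree_C_mul_X_pow_le (Complex.exp (y * Complex.I)) 1
      rw [pow_one] at this
      nlinarith
    have h2 : (C (1 / 2 : ℂ) * (X + 1)).natDegree ≤ 1 := by
      refine (natDegree_C_mul_le _ _).trans ?_
      refine (natDegree_add_le _ _).trans ?_
      simp
    have h3 := natDegree_pow_le_of_le (2 * n) h2
    exact natDegree_mul_le.trans (by omega)
  have hnorm : ∀ u : ℝ, ‖Q.eval (Complex.exp (u * Complex.I))‖ =
      |P (y + u)| * (Real.cos (u / 2) ^ 2) ^ n := by
    intro u
    have e1 : Complex.exp (y * Complex.I) * Complex.exp (u * Complex.I) =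
        Complex.exp (((y + u : ℝ) : ℂ) * Complex.I) := by
      rw [← Complex.exp_add]; congr 1; push_cast; ring
    have e2 : (1 / 2 : ℂ) * (Complex.exp (u * Complex.I) + 1) =
        Complex.exp (((u / 2 : ℝ) : ℂ) * Complex.I) * ((Real.cos (u / 2) : ℝ) : ℂ) := by
      have e3 : Complex.exp (u * Complex.I) = Complex.exp (((u / 2 : ℝ) : ℂ) * Complex.I) *
          Complex.exp (((u / 2 : ℝ) : ℂ) * Complex.I) := by
        rw [← Complex.exp_add]; congr 1; push_cast; ring
      have e4 : Complex.exp (((u / 2 : ℝ) : ℂ) * Complex.I) *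
          Complex.exp (-((u / 2 : ℝ) : ℂ) * Complex.I) = 1 := by
        rw [← Complex.exp_add]; simp
      rw [Complex.ofReal_cos, Complex.cos, e3]
      linear_combination (-1 / 2 : ℂ) * e4
    simp only [hQ, eval_mul, eval_comp, eval_C, eval_X, eval_pow, eval_add, eval_one]
    rw [e1, h, e2, norm_mul, norm_mul, norm_pow, norm_mul, Complex.norm_exp_ofReal_mul_I,
      Complex.norm_exp, Complex.norm_real, Complex.norm_real, one_mul, pow_mul]
    simp
  have := norm_eval_exp_le_integral Q hdeg x
  simp_rw [hnorm] at this
  exact_mod_cast this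

lemma one_half_le_cos_sq_pow {n : ℕ} {u : ℝ} (h : 4 * n * |u| ≤ 1) :
    1 / 2 ≤ (Real.cos (u / 2) ^ 2) ^ n := by
  rcases Nat.eq_zero_or_pos n with rfl | hn
  · norm_num
  have hn' : (1 : ℝ) ≤ n := by exact_mod_cast hn
  have h1 : 1 - u ^ 2 / 4 ≤ Real.cos (u / 2) ^ 2 := by
    have h2 := Real.sin_sq_add_cos_sq (u / 2)
    have h3 : Real.sin (u / 2) ^ 2 ≤ (u / 2) ^ 2 := sq_le_sq.mpr Real.abs_sin_le_abs
    nlinarith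
  have hu : |u| ≤ 1 / 4 := by nlinarith [abs_nonneg u]
  have hu2 : u ^ 2 = |u| ^ 2 := (sq_abs u).symm
  have h4 : 1 + (n : ℝ) * (-(u ^ 2 / 4)) ≤ (1 + -(u ^ 2 / 4)) ^ n :=
    one_add_mul_le_pow (by rw [hu2]; nlinarith [abs_nonneg u]) n
  have h5 : (1 + -(u ^ 2 / 4)) ^ n ≤ (Real.cos (u / 2) ^ 2) ^ n :=
    pow_le_pow_left₀ (by rw [hu2]; nlinarith [abs_nonneg u]) (by linarith) n
  have h6 : (n : ℝ) * u ^ 2 ≤ 1 := by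
    rw [hu2]; nlinarith [abs_nonneg u]
  linarith

/-- A localized weighted inequality for trigonometric polynomials: the weight `|u|` costs at
most a factor of the order of the degree, up to an exponentially small error. -/
lemma IsTrigPoly.integral_abs_mul_le {n : ℕ} (hn : 1 ≤ n) {P : ℝ → ℝ} (hP : IsTrigPoly n P)
    {S : ℝ} (hS : ∀ t, |P t| ≤ S) (y : ℝ) {r : ℝ} (hr : 0 < r) {ρ : ℝ → ℝ}
    (hρc : Continuous ρ) (hρ0 : ∀ u, 0 ≤ ρ u) (hρ1 : ∀ u, ρ u ≤ 1)
    (hρ : ∀ u, |u| ≤ r / 2 → ρ u = 1) :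
    ∫ u in (-Real.pi)..Real.pi, |P (y + u)| * ρ u ≤
      20 * n * (∫ u in (-Real.pi)..Real.pi, |u| * (|P (y + u)| * ρ u)) +
        32 * Real.pi ^ 2 * n * (S * (Real.cos (r / 4) ^ 2) ^ n) := by
  have hπ := Real.pi_pos
  have hn' : (1 : ℝ) ≤ n := by exact_mod_cast hn
  have hPc : Continuous P := (hP.contDiff (m := 0)).continuous
  have hS0 : 0 ≤ S := (abs_nonneg _).trans (hS 0)
  have hle : -Real.pi ≤ Real.pi := by linarith
  set Φ : ℝ → ℝ := fun u => |P (y + u)| * (Real.cos (u / 2) ^ 2) ^ n with hΦ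
  have hΦc : Continuous Φ := by fun_prop
  have hΦ0 : ∀ u, 0 ≤ Φ u := fun u => by positivity
  have hΦle : ∀ u, Φ u ≤ |P (y + u)| := fun u =>
    mul_le_of_le_one_right (abs_nonneg _)
      (pow_le_one₀ (by positivity) (Real.cos_sq_le_one _))
  set I : ℝ := ∫ u in (-Real.pi)..Real.pi, Φ u with hI
  have hI0 : 0 ≤ I := intervalIntegral.integral_nonneg hle fun u _ => hΦ0 u
  have hsup : ∀ u, Φ u ≤ (4 * n + 1) * I / (2 * Real.pi) := fun u => by
    rw [le_div_iff₀ (by positivity)]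
    exact hP.mul_cos_pow_le_integral y u
  set L : ℝ := ∫ u in (-Real.pi)..Real.pi, |u| * (|P (y + u)| * ρ u) with hL
  have hIL : I ≤ 8 * n * ∫ u in (-Real.pi)..Real.pi, |u| * Φ u := by
    set h : ℝ := 1 / (4 * n) with hh
    have hh0 : 0 < h := by positivity
    have hhle : h ≤ 1 / 4 := by
      rw [hh]; gcongr; linarith
    have hhn : 4 * n * h = 1 := by rw [hh]; field_simp
    have hπ3 := Real.pi_gt_three
    have hsplit : I = (∫ u in (-Real.pi)..(-h), Φ u) + (∫ u in (-h)..h, Φ u)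
        + ∫ u in h..Real.pi, Φ u := by
      rw [hI, intervalIntegral.integral_add_adjacent_intervals,
        intervalIntegral.integral_add_adjacent_intervals] <;>
      exact hΦc.intervalIntegrable _ _
    have hΨc : Continuous fun u => |u| * Φ u := by fun_prop
    have hsplit' : ∫ u in (-Real.pi)..Real.pi, |u| * Φ u =
        (∫ u in (-Real.pi)..(-h), |u| * Φ u) + (∫ u in (-h)..h, |u| * Φ u)
        + ∫ u in h..Real.pi, |u| * Φ u := by
      rw [intervalIntegral.integral_add_adjacent_intervals,
        intervalIntegral.integral_add_adjacent_intervals] <;>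
      exact hΨc.intervalIntegrable _ _
    have hmid : ∫ u in (-h)..h, Φ u ≤ I / 2 := by
      have h1 : ∫ u in (-h)..h, Φ u ≤
          ∫ u in (-h)..h, (4 * n + 1) * I / (2 * Real.pi) :=
        intervalIntegral.integral_mono_on (by linarith) (hΦc.intervalIntegrable _ _) (by simp)
          fun u _ => hsup u
      rw [intervalIntegral.integral_const, smul_eq_mul] at h1
      refine h1.trans ?_
      rw [← mul_div_assoc, div_le_iff₀ (by positivity)]
      nlinarith
    have hmid' : 0 ≤ ∫ u in (-h)..h, |u| * Φ u :=
      intervalIntegral.integral_nonneg (by linarith) fun u _ =>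
        mul_nonneg (abs_nonneg _) (hΦ0 u)
    have hpt : ∀ u, h ≤ |u| → Φ u ≤ 4 * n * (|u| * Φ u) := fun u hu => by
      have : 1 ≤ 4 * n * |u| := by rw [← hhn]; gcongr
      nlinarith [hΦ0 u]
    have hl : ∫ u in (-Real.pi)..(-h), Φ u ≤
        4 * n * ∫ u in (-Real.pi)..(-h), |u| * Φ u := by
      rw [← intervalIntegral.integral_const_mul]
      refine intervalIntegral.integral_mono_on (by linarith) (hΦc.intervalIntegrable _ _)
        ((continuous_const.mul hΨc).intervalIntegrable _ _) fun u hu => hpt u ?_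
      rw [abs_of_neg (by linarith [hu.2])]
      linarith [hu.2]
    have hr' : ∫ u in h..Real.pi, Φ u ≤ 4 * n * ∫ u in h..Real.pi, |u| * Φ u := by
      rw [← intervalIntegral.integral_const_mul]
      refine intervalIntegral.integral_mono_on (by linarith) (hΦc.intervalIntegrable _ _)
        ((continuous_const.mul hΨc).intervalIntegrable _ _) fun u hu => hpt u ?_
      exact hu.1.trans (le_abs_self u)
    rw [hsplit']
    nlinarith
  have htail : ∫ u in (-Real.pi)..Real.pi, |u| * Φ u ≤
      L + 2 * Real.pi ^ 2 * (S * (Real.cos (r / 4) ^ 2) ^ n) := by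
    have h1 : ∫ u in (-Real.pi)..Real.pi, |u| * Φ u ≤ ∫ u in (-Real.pi)..Real.pi,
        (|u| * (|P (y + u)| * ρ u) + Real.pi * (S * (Real.cos (r / 4) ^ 2) ^ n)) := by
      refine intervalIntegral.integral_mono_on hle
        ((by fun_prop : Continuous _).intervalIntegrable _ _)
        ((by fun_prop : Continuous _).intervalIntegrable _ _) fun u hu => ?_
      have hu' : |u| ≤ Real.pi := abs_le.mpr hu
      rcases le_or_gt |u| (r / 2) with hur | hur
      · rw [hρ u hur, mul_one]
        have : |u| * Φ u ≤ |u| * |P (y + u)| :=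
          mul_le_mul_of_nonneg_left (hΦle u) (abs_nonneg u)
        have h0 : 0 ≤ Real.pi * (S * (Real.cos (r / 4) ^ 2) ^ n) := by positivity
        linarith
      · have hcos : Real.cos (u / 2) ^ 2 ≤ Real.cos (r / 4) ^ 2 := by
          have h2 : Real.cos (u / 2) ≤ Real.cos (r / 4) := by
            rw [← Real.cos_abs (u / 2), abs_div, abs_two]
            exact Real.cos_le_cos_of_nonneg_of_le_pi (by positivity) (by linarith) (by linarith)
          have h3 : 0 ≤ Real.cos (u / 2) :=
            Real.cos_nonneg_of_mem_Icc ⟨by linarith [hu.1], by linarith [hu.2]⟩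
          exact pow_le_pow_left₀ h3 h2 2
        have h4 : Φ u ≤ S * (Real.cos (r / 4) ^ 2) ^ n :=
          mul_le_mul (hS _) (pow_le_pow_left₀ (sq_nonneg _) hcos n) (by positivity) hS0
        have h5 : |u| * Φ u ≤ Real.pi * (S * (Real.cos (r / 4) ^ 2) ^ n) :=
          mul_le_mul hu' h4 (hΦ0 u) hπ.le
        have h6 : 0 ≤ |u| * (|P (y + u)| * ρ u) :=
          mul_nonneg (abs_nonneg _) (mul_nonneg (abs_nonneg _) (hρ0 u))
        linarith
    refine h1.trans (le_of_eq ?_)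
    rw [intervalIntegral.integral_add ((by fun_prop : Continuous _).intervalIntegrable _ _)
      (by simp), intervalIntegral.integral_const, smul_eq_mul]
    ring
  have hmain : ∫ u in (-Real.pi)..Real.pi, |P (y + u)| * ρ u ≤ 4 * n * L + 2 * I := by
    rw [hL, hI, ← intervalIntegral.integral_const_mul, ← intervalIntegral.integral_const_mul,
      ← intervalIntegral.integral_add ((by fun_prop : Continuous _).intervalIntegrable _ _)
        ((by fun_prop : Continuous _).intervalIntegrable _ _)]
    refine intervalIntegral.integral_mono_on hle
        ((by fun_prop : Continuous _).intervalIntegrable _ _)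
        ((by fun_prop : Continuous _).intervalIntegrable _ _) fun u hu => ?_
    have hm0 : 0 ≤ |P (y + u)| * ρ u := mul_nonneg (abs_nonneg _) (hρ0 u)
    rcases le_or_gt (4 * n * |u|) 1 with hu1 | hu1
    · have h1 := one_half_le_cos_sq_pow hu1
      have h2 : |P (y + u)| * (1 / 2) ≤ Φ u := mul_le_mul_of_nonneg_left h1 (abs_nonneg _)
      have h3 : |P (y + u)| * ρ u ≤ |P (y + u)| :=
        mul_le_of_le_one_right (abs_nonneg _) (hρ1 u)
      have h4 : 0 ≤ 4 * (n : ℝ) * (|u| * (|P (y + u)| * ρ u)) := by positivity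
      linarith
    · nlinarith [hΦ0 u]
  have hIL2 : I ≤ 8 * n * (L + 2 * Real.pi ^ 2 * (S * (Real.cos (r / 4) ^ 2) ^ n)) :=
    hIL.trans (mul_le_mul_of_nonneg_left htail (by positivity))
  nlinarith

/-- Moving `q` derivatives onto a compactly supported test function. -/
lemma abs_integral_mul_iteratedDeriv_le (q : ℕ) {F φ : ℝ → ℝ} (hF : ContDiff ℝ q F)
    (hφ : ContDiff ℝ q φ) (hφc : HasCompactSupport φ) {δ : ℝ} (hδ : ∀ x, |F x| ≤ δ) :
    |∫ u, φ u * iteratedDeriv q F u| ≤ δ * ∫ u, |iteratedDeriv q φ u| := by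
  induction q generalizing φ with
  | zero =>
    simp only [iteratedDeriv_zero]
    have hφi : MeasureTheory.Integrable φ := hφ.continuous.integrable_of_hasCompactSupport hφc
    rw [← MeasureTheory.integral_const_mul, ← Real.norm_eq_abs]
    refine MeasureTheory.norm_integral_le_of_norm_le (hφi.abs.const_mul δ)
      (Filter.Eventually.of_forall fun u => ?_)
    rw [Real.norm_eq_abs, abs_mul, mul_comm]
    exact mul_le_mul_of_nonneg_right (hδ u) (abs_nonneg _)
  | succ q ih =>
    have hφ' : ContDiff ℝ q (deriv φ) := by
      have h : ContDiff ℝ (q + 1) φ := by exact_mod_cast hφ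
      exact (contDiff_succ_iff_deriv.mp h).2.2
    have hφcont : Continuous φ := hφ.continuous
    have hF1 : Continuous (iteratedDeriv q F) :=
      hF.continuous_iteratedDeriv q (by exact_mod_cast Nat.le_succ q)
    have hF2 : Continuous (iteratedDeriv (q + 1) F) := hF.continuous_iteratedDeriv (q + 1) le_rfl
    have hd : ∀ x, HasDerivAt (iteratedDeriv q F) (iteratedDeriv (q + 1) F x) x := fun x => by
      rw [iteratedDeriv_succ]
      exact (hF.differentiable_iteratedDeriv q (by exact_mod_cast Nat.lt_succ_self q) x).hasDerivAt
    have hφd : ∀ x, HasDerivAt φ (deriv φ x) x := fun x =>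
      (hφ.differentiable (by simp) x).hasDerivAt
    have h := MeasureTheory.integral_mul_deriv_eq_deriv_mul_of_integrable
      (u := φ) (v := iteratedDeriv q F) (u' := deriv φ) (v' := iteratedDeriv (q + 1) F)
      (fun x _ => hφd x) (fun x _ => hd x)
      ((hφcont.mul hF2).integrable_of_hasCompactSupport hφc.mul_right)
      ((hφ'.continuous.mul hF1).integrable_of_hasCompactSupport hφc.deriv.mul_right)
      ((hφcont.mul hF1).integrable_of_hasCompactSupport hφc.mul_right)
    rw [h, abs_neg, iteratedDeriv_succ']
    exact ih (hF.of_le (by exact_mod_cast Nat.le_succ q)) hφ' hφc.deriv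

lemma QMonotoneOn.iteratedDeriv_nonneg {q : ℕ} (hq : 2 ≤ q) {F : ℝ → ℝ} {a b : ℝ}
    (h : QMonotoneOn q F a b) (hF : ContDiff ℝ q F) {x : ℝ} (hx : x ∈ Set.Ioo a b) :
    0 ≤ iteratedDeriv q F x := by
  obtain ⟨k, rfl⟩ : ∃ k, q = k + 2 := ⟨q - 2, by omega⟩
  obtain ⟨-, -, hc⟩ := h
  simp only [Nat.add_sub_cancel] at hc
  have hEq : Set.EqOn (iteratedDerivWithin k F (Set.Ioo a b)) (iteratedDeriv k F)
      (Set.Ioo a b) := iteratedDerivWithin_of_isOpen isOpen_Ioo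
  have hc' : ConvexOn ℝ (Set.Ioo a b) (iteratedDeriv k F) := hc.congr hEq
  have hdiff : DifferentiableOn ℝ (iteratedDeriv k F) (Set.Ioo a b) :=
    (hF.differentiable_iteratedDeriv k (by exact_mod_cast (by omega))).differentiableOn
  have hm : MonotoneOn (deriv (iteratedDeriv k F)) (Set.Ioo a b) :=
    hc'.monotoneOn_deriv fun x hx => hdiff.differentiableAt (isOpen_Ioo.mem_nhds hx)
  have h1 := hm.derivWithin_nonneg (x := x)
  rw [derivWithin_of_isOpen isOpen_Ioo hx] at h1
  rwa [iteratedDeriv_succ, iteratedDeriv_succ]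

lemma QMonotoneOn.of_iteratedDeriv_nonneg {q : ℕ} (hq : 2 ≤ q) {F : ℝ → ℝ} {a b : ℝ}
    (hF : ContDiff ℝ q F) (h : ∀ x ∈ Set.Ioo a b, 0 ≤ iteratedDeriv q F x) :
    QMonotoneOn q F a b := by
  obtain ⟨k, rfl⟩ : ∃ k, q = k + 2 := ⟨q - 2, by omega⟩
  refine ⟨hF.continuous.continuousOn, ?_, ?_⟩
  · exact (hF.of_le (by exact_mod_cast (by omega))).contDiffOn
  simp only [Nat.add_sub_cancel]
  have hEq : Set.EqOn (iteratedDerivWithin k F (Set.Ioo a b)) (iteratedDeriv k F)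
      (Set.Ioo a b) := iteratedDerivWithin_of_isOpen isOpen_Ioo
  refine ConvexOn.congr ?_ hEq.symm
  refine convexOn_of_deriv2_nonneg' (convex_Ioo a b) ?_ ?_ fun x hx => ?_
  · exact (hF.differentiable_iteratedDeriv k (by exact_mod_cast (by omega))).differentiableOn
  · rw [← iteratedDeriv_succ]
    exact (hF.differentiable_iteratedDeriv (k + 1)
      (by exact_mod_cast (by omega))).differentiableOn
  · have := h x hx
    rw [iteratedDeriv_succ, iteratedDeriv_succ] at this
    simpa using this

lemma QMonotoneOn.zero (q : ℕ) (a b : ℝ) : QMonotoneOn q (fun _ => 0) a b := by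
  refine ⟨continuousOn_const, contDiffOn_const, ?_⟩
  have : Set.EqOn (fun _ => (0 : ℝ))
      (iteratedDerivWithin (q - 2) (fun _ : ℝ => (0 : ℝ)) (Set.Ioo a b)) (Set.Ioo a b) := by
    intro x _
    simp
  exact (convexOn_const 0 (convex_Ioo a b)).congr this

lemma le_errCoQ {q n s : ℕ} {Y : PtsColl s} {f : ℝ → ℝ} {c : ℝ}
    (h : ∀ T, IsTrigPoly n T → DeltaQ q s Y T → c ≤ ⨆ x : ℝ, |f x - T x|) :
    c ≤ ErrCoQ q n s Y f := by
  refine le_csInf ?_ ?_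
  · refine ⟨_, Set.mem_image_of_mem _ (x := fun _ => (0 : ℝ)) ⟨⟨0, 0, fun t => by simp⟩,
      continuous_const, fun _ => rfl, fun i _ _ => ?_⟩⟩
    simpa using QMonotoneOn.zero q (Y.y i) (Y.y (i - 1))
  · rintro _ ⟨T, ⟨hT, hD⟩, rfl⟩
    exact h T hT hD

lemma IsTrigPoly.exists_abs_le {n : ℕ} {T : ℝ → ℝ} (hT : IsTrigPoly n T) :
    ∃ K, ∀ t, |T t| ≤ K := by
  obtain ⟨a, b, h⟩ := hT
  refine ⟨|a 0| + ∑ k ∈ Finset.Icc 1 n, (|a k| + |b k|), fun t => ?_⟩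
  rw [h t]
  refine (abs_add_le _ _).trans (add_le_add le_rfl ((Finset.abs_sum_le_sum_abs _ _).trans
    (Finset.sum_le_sum fun k _ => (abs_add_le _ _).trans (add_le_add ?_ ?_))))
  · rw [abs_mul]
    exact mul_le_of_le_one_right (abs_nonneg _) (Real.abs_cos_le_one _)
  · rw [abs_mul]
    exact mul_le_of_le_one_right (abs_nonneg _) (Real.abs_sin_le_one _)

/-- Comparison of a function whose `q`-th derivative is locally a narrow hump to the right of `y`
with a trigonometric polynomial whose `q`-th derivative changes sign at `y`. -/
lemma exists_integral_hump_le (q : ℕ) (y : ℝ) {r : ℝ} (hr : 0 < r) (hrπ : r < Real.pi) :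
    ∃ C : ℝ, 0 < C ∧ ∀ n : ℕ, 1 ≤ n → 1 / (40 * (n : ℝ)) ≤ r / 2 →
      ∀ (f T : ℝ → ℝ) (S lam : ℝ), ContDiff ℝ q f → IsTrigPoly n T → 0 ≤ lam →
      (∀ x, |f x - T x| ≤ lam) → (∀ x, |iteratedDeriv q T x| ≤ S) →
      (∀ u, |u| < r → u < 0 ∨ 1 / (40 * n) < u → iteratedDeriv q f (y + u) = 0) →
      (∀ u ∈ Set.Icc (0 : ℝ) (1 / (40 * n)), 0 ≤ iteratedDeriv q f (y + u)) →
      (∀ u, 0 < u → u < r → 0 ≤ iteratedDeriv q T (y + u)) →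
      (∀ u, u < 0 → -r < u → iteratedDeriv q T (y + u) ≤ 0) →
      ∫ u in (0 : ℝ)..1 / (40 * n), iteratedDeriv q f (y + u) ≤
        2 * (lam * (n * C)) + 64 * Real.pi ^ 2 * n * (S * (Real.cos (r / 4) ^ 2) ^ n) := by
  have hπ := Real.pi_pos
  -- the cut-off and the two test functions
  let ρ : ContDiffBump (0 : ℝ) := ⟨r / 2, r, by positivity, by linarith⟩
  have hρsm : ContDiff ℝ q (fun u => ρ u) := ρ.contDiff
  have hρcont : Continuous fun u => ρ u := hρsm.continuous
  have hρcs : HasCompactSupport fun u => ρ u := ρ.hasCompactSupport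
  have hρone : ∀ u : ℝ, |u| ≤ r / 2 → ρ u = 1 := fun u hu =>
    ρ.one_of_mem_closedBall (by simpa [Metric.mem_closedBall, Real.dist_eq] using hu)
  have hρzero : ∀ u : ℝ, r ≤ |u| → ρ u = 0 := fun u hu =>
    ρ.zero_of_le_dist (by simpa [Real.dist_eq] using hu)
  set C0 : ℝ := ∫ u, |iteratedDeriv q (fun u => ρ u) u| with hC0
  set C1 : ℝ := ∫ u, |iteratedDeriv q (fun u => u * ρ u) u| with hC1
  have hC0n : 0 ≤ C0 := MeasureTheory.integral_nonneg fun _ => abs_nonneg _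
  have hC1n : 0 ≤ C1 := MeasureTheory.integral_nonneg fun _ => abs_nonneg _
  have hwsm : ContDiff ℝ q (fun u => u * ρ u) := contDiff_id.mul hρsm
  have hwcs : HasCompactSupport fun u => u * ρ u := hρcs.mul_left
  have hconv : ∀ G : ℝ → ℝ, ∫ u, ρ u * G u = ∫ u in (-Real.pi)..Real.pi, ρ u * G u := by
    intro G
    rw [intervalIntegral.integral_eq_integral_of_support_subset]
    intro u hu
    have : ρ u ≠ 0 := fun h => hu (by simp [h])
    have h1 : |u| < r := by
      by_contra h
      exact this (hρzero u (not_lt.mp h))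
    rw [abs_lt] at h1
    exact ⟨by linarith, by linarith⟩
  refine ⟨C0 + 20 * C1 + 1, by positivity, ?_⟩
  intro n hn hnr f T S lam hf hT hlam0 hdiff hPS hf0 hfn hPpos hPneg
  have hn' : (1 : ℝ) ≤ n := by exact_mod_cast hn
  have hnpos : (0 : ℝ) < n := by linarith
  have hTsm : ContDiff ℝ q T := hT.contDiff
  set g : ℝ → ℝ := fun u => iteratedDeriv q f (y + u) with hg
  set P : ℝ → ℝ := fun u => iteratedDeriv q T (y + u) with hP
  have hgc : Continuous g :=
    (hf.continuous_iteratedDeriv q le_rfl).comp (continuous_const.add continuous_id)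
  have hPc : Continuous P :=
    (hTsm.continuous_iteratedDeriv q le_rfl).comp (continuous_const.add continuous_id)
  have hfs : ContDiff ℝ q fun u => f (y + u) := hf.comp (contDiff_const.add contDiff_id)
  have hTs : ContDiff ℝ q fun u => T (y + u) := hTsm.comp (contDiff_const.add contDiff_id)
  have hFd : ∀ u, iteratedDeriv q (fun u => f (y + u) - T (y + u)) u = g u - P u := fun u => by
    rw [iteratedDeriv_fun_sub hfs.contDiffAt hTs.contDiffAt, iteratedDeriv_comp_const_add,
      iteratedDeriv_comp_const_add]
  have hM : |(∫ u in (-Real.pi)..Real.pi, ρ u * g u) -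
      ∫ u in (-Real.pi)..Real.pi, ρ u * P u| ≤ lam * C0 := by
    have h := abs_integral_mul_iteratedDeriv_le q (hfs.sub hTs) hρsm hρcs
      (fun x => hdiff (y + x))
    simp_rw [hFd] at h
    rw [hconv] at h
    simp_rw [mul_sub] at h
    rwa [intervalIntegral.integral_sub (f := fun u => ρ u * g u) (g := fun u => ρ u * P u)
      ((hρcont.mul hgc).intervalIntegrable _ _) ((hρcont.mul hPc).intervalIntegrable _ _)] at h
  have hL : |(∫ u in (-Real.pi)..Real.pi, ρ u * (u * g u)) -
      ∫ u in (-Real.pi)..Real.pi, ρ u * (u * P u)| ≤ lam * C1 := by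
    have h := abs_integral_mul_iteratedDeriv_le q (hfs.sub hTs) hwsm hwcs
      (fun x => hdiff (y + x))
    simp_rw [hFd, mul_comm _ (ρ _), mul_assoc] at h
    rw [hconv] at h
    simp_rw [mul_sub] at h
    rw [intervalIntegral.integral_sub (f := fun u => ρ u * (u * g u))
      (g := fun u => ρ u * (u * P u))
      ((hρcont.mul (continuous_id.mul hgc)).intervalIntegrable _ _)
      ((hρcont.mul (continuous_id.mul hPc)).intervalIntegrable _ _)] at h
    simpa only [hC1, mul_comm _ (ρ _)] using h
  have hPpos : ∀ u, 0 < u → u < r → 0 ≤ P u := hPpos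
  have hPneg : ∀ u, u < 0 → -r < u → P u ≤ 0 := hPneg
  have hPabs : ∀ u, |u| * (|P u| * ρ u) = ρ u * (u * P u) := fun u => by
    rcases le_or_gt r |u| with h | h
    · simp [hρzero u h]
    rw [abs_lt] at h
    rcases lt_trichotomy u 0 with h0 | rfl | h0
    · rw [abs_of_neg h0, abs_of_nonpos (hPneg u h0 h.1)]; ring
    · simp
    · rw [abs_of_pos h0, abs_of_nonneg (hPpos u h0 h.2)]; ring
  have hkey := (hT.iteratedDeriv q).integral_abs_mul_le hn hPS y hr
    hρcont (fun u => ρ.nonneg) (fun u => ρ.le_one) hρone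
  change ∫ u in (-Real.pi)..Real.pi, |P u| * ρ u ≤
    20 * n * (∫ u in (-Real.pi)..Real.pi, |u| * (|P u| * ρ u)) + _ at hkey
  simp_rw [hPabs] at hkey
  have hMT : ∫ u in (-Real.pi)..Real.pi, ρ u * P u ≤
      ∫ u in (-Real.pi)..Real.pi, |P u| * ρ u := by
    refine intervalIntegral.integral_mono_on (by linarith)
      ((hρcont.mul hPc).intervalIntegrable _ _) ((hPc.abs.mul hρcont).intervalIntegrable _ _)
      fun u _ => ?_
    rw [mul_comm]
    exact mul_le_mul_of_nonneg_right (le_abs_self _) ρ.nonneg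
  set b : ℝ := 1 / (40 * n) with hb
  have hb0 : 0 < b := by positivity
  have hcase : ∀ u, (ρ u = 0 ∨ g u = 0) ∨ u ∈ Set.Icc 0 b := fun u => by
    rcases le_or_gt r |u| with h | h
    · exact Or.inl (Or.inl (hρzero u h))
    by_cases h' : u < 0 ∨ b < u
    · exact Or.inl (Or.inr (hf0 u h h'))
    · push Not at h'
      exact Or.inr h'
  have hρg : ∀ u, 0 ≤ ρ u * g u := fun u => by
    rcases hcase u with (h | h) | h
    · simp [h]
    · simp [h]
    · exact mul_nonneg ρ.nonneg (hfn u h)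
  have hLf : ∫ u in (-Real.pi)..Real.pi, ρ u * (u * g u) ≤
      b * ∫ u in (-Real.pi)..Real.pi, ρ u * g u := by
    rw [← intervalIntegral.integral_const_mul]
    refine intervalIntegral.integral_mono_on (by linarith)
      ((hρcont.mul (continuous_id.mul hgc)).intervalIntegrable _ _)
      ((continuous_const.mul (hρcont.mul hgc)).intervalIntegrable _ _) fun u _ => ?_
    rcases hcase u with (h | h) | h
    · simp [h]
    · simp [h]
    · nlinarith [hρg u, h.2]
  change ∫ u in (0 : ℝ)..b, g u ≤ _
  have hMf : ∫ u in (0 : ℝ)..b, g u ≤ ∫ u in (-Real.pi)..Real.pi, ρ u * g u := by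
    have h1 : ∫ u in (0 : ℝ)..b, g u = ∫ u in (0 : ℝ)..b, ρ u * g u := by
      refine intervalIntegral.integral_congr fun u hu => ?_
      rw [Set.uIcc_of_le hb0.le] at hu
      rw [hρone u (by rw [abs_of_nonneg hu.1]; linarith [hu.2]), one_mul]
    rw [h1]
    exact intervalIntegral.integral_mono_interval (by linarith) hb0.le (by linarith)
      (Filter.Eventually.of_forall hρg) ((hρcont.mul hgc).intervalIntegrable _ _)
  have hbn : 20 * n * b = 1 / 2 := by rw [hb]; field_simp; norm_num
  rw [abs_le] at hM hL
  have e1 : lam * C0 + 20 * n * (lam * C1) ≤ lam * (n * (C0 + 20 * C1 + 1)) := by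
    have h2 : lam * C0 ≤ lam * (n * C0) := by
      have := mul_le_mul_of_nonneg_right hn' hC0n
      rw [one_mul] at this
      exact mul_le_mul_of_nonneg_left this hlam0
    have h3 : 0 ≤ lam * n := by positivity
    nlinarith
  have e2 : 20 * n * (∫ u in (-Real.pi)..Real.pi, ρ u * (u * P u)) ≤
      20 * n * (b * (∫ u in (-Real.pi)..Real.pi, ρ u * g u) + lam * C1) := by
    refine mul_le_mul_of_nonneg_left ?_ (by positivity)
    linarith [hL.1]
  rw [mul_add, ← mul_assoc, hbn] at e2
  linarith [hM.2]

/-- The lower bound for co-`q`-monotone approximation of a function whose `q`-th derivative is,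
near `y 1`, a hump of width comparable to `1 / n` next to `y 1`. -/
lemma eventually_lt_errCoQ (q s d : ℕ) (hq : 2 ≤ q) (hs : 1 ≤ s) (Y : PtsColl s) (ε : ℕ → ℝ)
    (hε : Filter.Tendsto ε Filter.atTop Filter.atTop) {r κ : ℝ} (B M : ℝ)
    (hr : 0 < r) (hrπ : r < Real.pi) (hr0 : r ≤ Y.y 0 - Y.y 1) (hr1 : r ≤ Y.y 1 - Y.y 2)
    (hκ : 0 < κ) :
    ∀ᶠ n : ℕ in Filter.atTop, ∀ f : ℝ → ℝ, ContDiff ℝ q f → (∀ x, |f x| ≤ B) →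
      (∀ u, |u| < r → u < 0 ∨ 1 / (40 * n) < u → iteratedDeriv q f (Y.y 1 + u) = 0) →
      (∀ u ∈ Set.Icc (0 : ℝ) (1 / (40 * n)), 0 ≤ iteratedDeriv q f (Y.y 1 + u)) →
      κ / (n : ℝ) ^ (d + 1) ≤
        ∫ u in (0 : ℝ)..1 / (40 * n), iteratedDeriv q f (Y.y 1 + u) →
      M < ε n * (n : ℝ) ^ (d + 2) * ErrCoQ q n s Y f := by
  have hπ := Real.pi_pos
  set y := Y.y 1 with hy
  obtain ⟨C, hCpos, hcore⟩ := exists_integral_hump_le q y hr hrπ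
  set θ : ℝ := Real.cos (r / 4) ^ 2 with hθ
  have hθ1 : |θ| < 1 := by
    rw [abs_of_nonneg (sq_nonneg _), hθ]
    have h1 := Real.sin_sq_add_cos_sq (r / 4)
    have h2 : 0 < Real.sin (r / 4) := Real.sin_pos_of_pos_of_lt_pi (by linarith) (by linarith)
    nlinarith
  have htiny := (tendsto_pow_const_mul_const_pow_of_abs_lt_one (d + 2 + 2 * q) hθ1).const_mul
    (32 * Real.pi ^ 2 * (7 ^ q * (B + 1)))
  rw [mul_zero] at htiny
  have hscale : Filter.Tendsto (fun n : ℕ => 1 / (40 * (n : ℝ))) Filter.atTop (nhds 0) := by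
    have := (tendsto_one_div_atTop_nhds_zero_nat (𝕜 := ℝ)).const_mul (1 / 40)
    rw [mul_zero] at this
    refine this.congr fun n => ?_
    rw [div_mul_div_comm, one_mul]
  filter_upwards [Filter.eventually_ge_atTop 1,
    htiny.eventually_lt_const (show (0 : ℝ) < κ / 8 by positivity),
    hscale.eventually_lt_const (show 0 < r / 2 by positivity),
    hε.eventually_gt_atTop (max 0 (M * (8 * C / κ))),
    Filter.eventually_ge_atTop (Nat.ceil (κ / (8 * C)))] with
    n hn hnt hnr hnε hnC f hf hfB hf0 hfn hfm
  have hn' : (1 : ℝ) ≤ n := by exact_mod_cast hn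
  have hnpos : (0 : ℝ) < n := by linarith
  set lam : ℝ := κ / (8 * C * (n : ℝ) ^ (d + 2)) with hlam
  have hlam0 : 0 < lam := by positivity
  have hlam1 : lam ≤ 1 := by
    have h1 : κ / (8 * C) ≤ n := (Nat.le_ceil _).trans (by exact_mod_cast hnC)
    rw [div_le_iff₀ (by positivity)] at h1
    rw [hlam, div_le_one (by positivity)]
    have h2 : (n : ℝ) ≤ (n : ℝ) ^ (d + 2) := le_self_pow₀ hn' (by omega)
    nlinarith
  suffices h : lam ≤ ErrCoQ q n s Y f by
    have hε0 : 0 < ε n := (le_max_left _ _).trans_lt hnε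
    have h1 : M * (8 * C / κ) < ε n := (le_max_right _ _).trans_lt hnε
    have h2 : M < ε n * (n : ℝ) ^ (d + 2) * lam := by
      rw [hlam]
      rw [← mul_div_assoc, div_eq_mul_inv] at h1
      have e : ε n * (n : ℝ) ^ (d + 2) * (κ / (8 * C * (n : ℝ) ^ (d + 2))) =
          ε n * κ / (8 * C) := by
        field_simp
      rw [e, lt_div_iff₀ (by positivity)]
      rwa [← div_eq_mul_inv, div_lt_iff₀ hκ] at h1
    exact h2.trans_le (mul_le_mul_of_nonneg_left h (by positivity))
  refine le_errCoQ fun T hT hTD => ?_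
  by_contra hcon
  push Not at hcon
  obtain ⟨hTc, hTp, hTm⟩ := hTD
  have hTsm : ContDiff ℝ q T := hT.contDiff
  have hdiff : ∀ x, |f x - T x| ≤ lam := by
    obtain ⟨K, hK⟩ := hT.exists_abs_le
    have hbdd : BddAbove (Set.range fun x => |f x - T x|) := by
      refine ⟨B + K, ?_⟩
      rintro _ ⟨x, rfl⟩
      exact (abs_sub _ _).trans (add_le_add (hfB x) (hK x))
    exact fun x => (le_ciSup hbdd x).trans hcon.le
  have hTB : ∀ x, |T x| ≤ B + 1 := fun x => by
    have h1 := abs_sub_abs_le_abs_sub (T x) (f x)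
    rw [abs_sub_comm] at h1
    linarith [hdiff x, hfB x]
  -- the sign of the `q`-th derivative of `T` near `y`
  have hPpos : ∀ u, 0 < u → u < r → 0 ≤ iteratedDeriv q T (y + u) := fun u h0 h1 => by
    have h2 := hTm 1 le_rfl (by omega)
    simp only [Nat.sub_self, pow_zero, one_mul] at h2
    exact h2.iteratedDeriv_nonneg hq hTsm ⟨by linarith, by linarith⟩
  have hPneg : ∀ u, u < 0 → -r < u → iteratedDeriv q T (y + u) ≤ 0 := fun u h0 h1 => by
    have h2 := hTm 2 (by omega) (by omega)
    norm_num at h2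
    have h3 := h2.iteratedDeriv_nonneg hq hTsm.neg (x := y + u) ⟨by linarith, by linarith⟩
    rw [iteratedDeriv_fun_neg] at h3
    linarith
  have hmain := hcore n hn hnr.le f T _ lam hf hT hlam0.le hdiff (hT.abs_iteratedDeriv_le hTB q)
    hf0 hfn hPpos hPneg
  have hnd : 0 < (n : ℝ) ^ (d + 1) := by positivity
  have htn : 32 * Real.pi ^ 2 * n * ((7 * (n : ℝ) ^ 2) ^ q * (B + 1) * θ ^ n) ≤
      κ / 8 / (n : ℝ) ^ (d + 1) := by
    rw [le_div_iff₀ hnd]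
    refine le_trans (le_of_eq ?_) hnt.le
    rw [mul_pow, ← pow_mul]
    ring
  have hlamn : lam * (n * C) = κ / 8 / (n : ℝ) ^ (d + 1) := by
    rw [hlam, pow_succ _ (d + 1)]
    field_simp
  have e3 : κ / 8 / (n : ℝ) ^ (d + 1) = (κ / (n : ℝ) ^ (d + 1)) / 8 := by ring
  have e4 : 0 < κ / (n : ℝ) ^ (d + 1) := by positivity
  linarith

lemma Function.Periodic.exists_antideriv {T : ℝ} (hT : 0 < T) {m : ℕ} {g : ℝ → ℝ}
    (hg : ContDiff ℝ m g) (hper : Function.Periodic g T) (hint : ∫ x in (0 : ℝ)..T, g x = 0) :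
    ∃ G : ℝ → ℝ, ContDiff ℝ (m + 1 : ℕ) G ∧ Function.Periodic G T ∧ deriv G = g ∧
      ∫ x in (0 : ℝ)..T, G x = 0 := by
  have hc := hg.continuous
  set G₀ : ℝ → ℝ := fun x => ∫ t in (0 : ℝ)..x, g t with hG₀
  have hd (x : ℝ) : HasDerivAt G₀ (g x) x := hc.integral_hasStrictDerivAt 0 x |>.hasDerivAt
  have hG₀c : Continuous G₀ := continuous_iff_continuousAt.2 fun x => (hd x).continuousAt
  set C : ℝ := (∫ t in (0 : ℝ)..T, G₀ t) / T with hC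
  have hd' (x : ℝ) : HasDerivAt (fun x => G₀ x - C) (g x) x := (hd x).sub_const C
  have hder : deriv (fun x => G₀ x - C) = g := funext fun x => (hd' x).deriv
  refine ⟨fun x => G₀ x - C, ?_, ?_, hder, ?_⟩
  · push_cast
    rw [contDiff_succ_iff_deriv]
    exact ⟨fun x => (hd' x).differentiableAt, by simp, by rwa [hder]⟩
  · intro x
    have h : G₀ (x + T) = G₀ x := by
      have h1 := intervalIntegral.integral_add_adjacent_intervals
        (hc.intervalIntegrable (μ := MeasureTheory.volume) 0 x) (hc.intervalIntegrable x (x + T))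
      rw [hper.intervalIntegral_add_eq x 0, zero_add, hint, add_zero] at h1
      exact h1.symm
    simp only [h]
  · rw [intervalIntegral.integral_sub (hG₀c.intervalIntegrable _ _) (by simp)]
    rw [intervalIntegral.integral_const, smul_eq_mul, sub_zero, hC]
    field_simp
    ring

lemma Function.Periodic.exists_iteratedDeriv_eq {T : ℝ} (hT : 0 < T) {m : ℕ} (q : ℕ) {g : ℝ → ℝ}
    (hg : ContDiff ℝ m g) (hper : Function.Periodic g T) (hint : ∫ x in (0 : ℝ)..T, g x = 0) :
    ∃ f : ℝ → ℝ, ContDiff ℝ (m + q : ℕ) f ∧ Function.Periodic f T ∧ iteratedDeriv q f = g := by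
  induction q generalizing m g with
  | zero => exact ⟨g, hg, hper, iteratedDeriv_zero⟩
  | succ q ih =>
    obtain ⟨G, hG, hGper, hder, hGint⟩ := hper.exists_antideriv hT hg hint
    obtain ⟨f, hf, hfper, hfG⟩ := ih hG hGper hGint
    refine ⟨f, ?_, hfper, ?_⟩
    · convert hf using 2
      ring_nf
    · rw [iteratedDeriv_succ, hfG, hder]

/-- The `T`-periodic extension of a `C^m` function supported inside one period is `C^m`. -/
lemma ContDiff.comp_toIcoMod {T a l u : ℝ} (hT : 0 < T) (hal : a < l) (hu : u < a + T) {m : ℕ}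
    {g : ℝ → ℝ} (hg : ContDiff ℝ m g) (hl : ∀ x ≤ l, g x = 0) (hr : ∀ x, u ≤ x → g x = 0) :
    ContDiff ℝ m (fun x => g (toIcoMod hT a x)) := by
  rw [contDiff_iff_contDiffAt]
  intro x
  set k := toIcoDiv hT a x
  have hx : x - k * T ∈ Set.Ico a (a + T) := by
    have h := toIcoMod_mem_Ico hT a x
    rwa [toIcoMod, zsmul_eq_mul] at h
  have key : (fun y => g (toIcoMod hT a y)) =ᶠ[nhds x] fun y => g (y - k * T) := by
    have hmod {y : ℝ} (h : y - k * T ∈ Set.Ico a (a + T)) : toIcoMod hT a y = y - k * T := by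
      rw [toIcoMod_eq_iff]
      exact ⟨h, k, by simp⟩
    have hcont : Continuous fun y : ℝ => y - k * T := by fun_prop
    rcases hx.1.eq_or_lt with h | h
    · have h1 : ∀ᶠ y in nhds x, y - k * T ∈ Set.Ioo (a - (a + T - u)) l :=
        hcont.continuousAt.eventually (Ioo_mem_nhds (by linarith) (by linarith))
      have h2 : ∀ᶠ y in nhds x, y - k * T ∈ Set.Ioo (a - T) (a + T) :=
        hcont.continuousAt.eventually (Ioo_mem_nhds (by linarith) (by linarith))
      filter_upwards [h1, h2] with y hy1 hy2
      rcases lt_or_ge (y - k * T) a with hya | hya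
      · have : toIcoMod hT a y = y - k * T + T := by
          rw [toIcoMod_eq_iff]
          refine ⟨⟨by linarith [hy2.1], by linarith⟩, k - 1, ?_⟩
          simp
          ring
        rw [this, hr _ (by linarith [hy1.1]), hl _ hy1.2.le]
      · rw [hmod ⟨hya, hy2.2⟩]
    · have h1 : ∀ᶠ y in nhds x, y - k * T ∈ Set.Ioo a (a + T) :=
        hcont.continuousAt.eventually (Ioo_mem_nhds h hx.2)
      filter_upwards [h1] with y hy
      rw [hmod (Set.Ioo_subset_Ico_self hy)]
  refine ContDiffAt.congr_of_eventuallyEq ?_ key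
  exact (hg.comp (contDiff_id.sub contDiff_const)).contDiffAt

lemma ContDiff.exists_bound_iteratedDeriv_of_hasCompactSupport {β : ℝ → ℝ} {d : ℕ}
    (hβ : ContDiff ℝ d β) (hs : HasCompactSupport β) {j : ℕ} (hj : j ≤ d) :
    ∃ C, ∀ x, |iteratedDeriv j β x| ≤ C := by
  have h1 : Continuous (iteratedDeriv j β) :=
    hβ.continuous_iteratedDeriv j (by exact_mod_cast hj)
  have h2 : HasCompactSupport (iteratedDeriv j β) := by
    have := hs.iteratedFDeriv (𝕜 := ℝ) j
    rw [HasCompactSupport, iteratedDeriv_eq_equiv_comp]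
    exact this.comp_left (by simp)
  exact h2.exists_bound_of_continuous h1

/-- A flat sum of humps: the `k`-th hump has height comparable to `2 ^ (-k) * b k ^ d` and is
supported in `(b k / 2, b k)`. -/
lemma exists_hump_series (d : ℕ) (b : ℕ → ℝ) (hb : ∀ k, 0 < b k) (hb0 : b 0 ≤ 1)
    (hstep : ∀ k, b (k + 1) ≤ b k / 2) :
    ∃ (A : ℝ → ℝ) (c : ℝ), 0 < c ∧ ContDiff ℝ d A ∧ (∀ u, 0 ≤ A u) ∧ (∀ u ≤ 0, A u = 0) ∧
      (∀ u, b 0 ≤ u → A u = 0) ∧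
      (∀ k u, b (k + 1) ≤ u → u ≤ b k / 2 → A u = 0) ∧
      ∀ k, c * (1 / 2) ^ k * b k ^ (d + 1) ≤ ∫ u in (0 : ℝ)..b k, A u := by
  have hanti : Antitone b := antitone_nat_of_succ_le fun k => by linarith [hstep k, hb k]
  let φ : ContDiffBump (3 / 4 : ℝ) := ⟨1 / 8, 1 / 4, by norm_num, by norm_num⟩
  have hφ0 : ∀ x, x ≤ 1 / 2 ∨ 1 ≤ x → φ x = 0 := by
    intro x hx
    apply φ.zero_of_le_dist
    rw [Real.dist_eq]
    show (1 / 4 : ℝ) ≤ _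
    rcases hx with hx | hx
    · rw [abs_of_nonpos (by linarith)]; linarith
    · rw [abs_of_nonneg (by linarith)]; linarith
  have hφc : ContDiff ℝ d φ := φ.contDiff
  choose! C hC using fun j (hj : j ≤ d) =>
    hφc.exists_bound_iteratedDeriv_of_hasCompactSupport φ.hasCompactSupport hj
  set a : ℕ → ℝ → ℝ := fun k u => (1 / 2) ^ k * b k ^ d * φ ((b k)⁻¹ * u) with ha
  have ha_nonneg (k : ℕ) (u : ℝ) : 0 ≤ a k u := by
    have := (hb k).le
    have := φ.nonneg (x := (b k)⁻¹ * u)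
    positivity
  have ha_zero (k : ℕ) (u : ℝ) (hu : u ≤ b k / 2 ∨ b k ≤ u) : a k u = 0 := by
    have hk := hb k
    simp only [ha]
    rw [hφ0, mul_zero]
    refine hu.imp (fun h => ?_) fun h => ?_
    · rw [inv_mul_le_iff₀ hk]; linarith
    · rw [le_inv_mul_iff₀ hk]; linarith
  have ha_cd (k : ℕ) : ContDiff ℝ d (a k) :=
    contDiff_const.mul (hφc.comp (contDiff_const.mul contDiff_id))
  have hbound (j k : ℕ) (u : ℝ) (hj : j ≤ d) :
      ‖iteratedFDeriv ℝ j (a k) u‖ ≤ C j * (1 / 2) ^ k := by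
    have hk := hb k
    have hk1 : b k ≤ 1 := (hanti (Nat.zero_le k)).trans hb0
    have e : iteratedDeriv j (a k) u =
        (1 / 2) ^ k * b k ^ d * ((b k)⁻¹ ^ j * iteratedDeriv j φ ((b k)⁻¹ * u)) := by
      simp only [ha]
      rw [iteratedDeriv_const_mul_field,
        iteratedDeriv_comp_const_mul (hφc.of_le (by exact_mod_cast hj))]
    have e2 : b k ^ d * (b k)⁻¹ ^ j = b k ^ (d - j) := by
      rw [← Nat.sub_add_cancel hj, pow_add, mul_assoc, ← mul_pow, mul_inv_cancel₀ hk.ne']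
      simp
    rw [norm_iteratedFDeriv_eq_norm_iteratedDeriv, e, Real.norm_eq_abs, abs_mul, abs_mul, abs_mul,
      abs_of_pos (by positivity), abs_of_pos (by positivity), abs_of_pos (by positivity)]
    calc (1 / 2 : ℝ) ^ k * b k ^ d * ((b k)⁻¹ ^ j * |iteratedDeriv j φ ((b k)⁻¹ * u)|)
        = (b k ^ d * (b k)⁻¹ ^ j) * (|iteratedDeriv j φ ((b k)⁻¹ * u)| * (1 / 2) ^ k) := by ring
      _ ≤ 1 * (C j * (1 / 2) ^ k) := by
          rw [e2]
          gcongr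
          · exact pow_le_one₀ hk.le hk1
          · exact hC j hj _
      _ = _ := one_mul _
  have hcd : ContDiff ℝ d (fun u => ∑' k, a k u) := by
    have := contDiff_tsum (𝕜 := ℝ) (N := (d : ℕ∞)) (f := a)
      (v := fun j k => C j * (1 / 2) ^ k) (fun k => ha_cd k)
      (fun j _ => (summable_geometric_two).mul_left _)
      (fun j k u hj => hbound j k u (by exact_mod_cast hj))
    exact this
  have hsum (u : ℝ) : Summable fun k => a k u := by
    refine Summable.of_norm_bounded ((summable_geometric_two).mul_left (C 0)) fun k => ?_
    have := hbound 0 k u (Nat.zero_le d)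
    rwa [norm_iteratedFDeriv_zero] at this
  have hzero (u : ℝ) (h : ∀ k, u ≤ b k / 2 ∨ b k ≤ u) : ∑' k, a k u = 0 := by
    simp [fun k => ha_zero k u (h k)]
  have hφint : 0 < ∫ x in (0 : ℝ)..1, φ x := by
    have hpos := φ.integral_pos (μ := MeasureTheory.volume)
    rwa [← intervalIntegral.integral_eq_integral_of_support_subset (a := 0) (b := 1)] at hpos
    intro x hx
    by_contra hx'
    refine hx (hφ0 x ?_)
    rw [Set.mem_Ioc, not_and_or] at hx'
    rcases hx' with h | h
    · left; linarith
    · right; linarith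
  refine ⟨fun u => ∑' k, a k u, _, hφint, hcd, fun u => tsum_nonneg fun k => ha_nonneg k u,
    fun u hu => hzero u fun k => Or.inl (by linarith [hb k]),
    fun u hu => hzero u fun k => Or.inr ((hanti (Nat.zero_le k)).trans hu),
    fun k u h1 h2 => hzero u fun j => ?_, fun k => ?_⟩
  · rcases le_or_gt j k with hj | hj
    · left
      linarith [hanti hj]
    · right
      exact (hanti hj).trans h1
  · have hk := hb k
    have e : ∫ u in (0 : ℝ)..b k, a k u =
        (∫ x in (0 : ℝ)..1, φ x) * (1 / 2) ^ k * b k ^ (d + 1) := by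
      simp only [ha]
      rw [intervalIntegral.integral_const_mul,
        intervalIntegral.integral_comp_mul_left (fun x => φ x) (inv_ne_zero hk.ne')]
      rw [mul_zero, inv_mul_cancel₀ hk.ne', inv_inv, smul_eq_mul]
      ring
    rw [← e]
    refine intervalIntegral.integral_mono_on hk.le ((ha_cd k).continuous.intervalIntegrable _ _)
      (hcd.continuous.intervalIntegrable _ _) fun u _ => ?_
    exact (hsum u).le_tsum k fun j _ => ha_nonneg j u

lemma PtsColl.le_of_le {s : ℕ} (Y : PtsColl s) {i j : ℕ} (hij : i ≤ j) (hj : j ≤ 2 * s) :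
    Y.y j ≤ Y.y i := by
  induction j, hij using Nat.le_induction with
  | base => exact le_rfl
  | succ j hij ih => exact (Y.lt (j + 1) (by omega) hj).le.trans (ih (by omega))

lemma exists_periodic_hump_function (d s : ℕ) (hs : 1 ≤ s) (Y : PtsColl s) (b : ℕ → ℝ)
    (hb : ∀ k, 0 < b k) (hb1 : b 0 ≤ 1) (hb0 : b 0 < Y.y 0 - Y.y 1)
    (hb2 : b 0 ≤ (Y.y 1 - Y.y 2) / 2) (hstep : ∀ k, b (k + 1) ≤ b k / 2) :
    ∃ (g : ℝ → ℝ) (c : ℝ), 0 < c ∧ ContDiff ℝ d g ∧ Function.Periodic g (2 * Real.pi) ∧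
      ∫ x in (0 : ℝ)..2 * Real.pi, g x = 0 ∧
      (∀ i, 1 ≤ i → i ≤ 2 * s →
        ∀ x ∈ Set.Ioo (Y.y i) (Y.y (i - 1)), 0 ≤ (-1 : ℝ) ^ (i - 1) * g x) ∧
      (∀ k u, |u| < b k / 2 → u < 0 ∨ b (k + 1) < u → g (Y.y 1 + u) = 0) ∧
      (∀ k, ∀ u ∈ Set.Icc 0 (b k), 0 ≤ g (Y.y 1 + u)) ∧
      ∀ k, c * (1 / 2) ^ k * b k ^ (d + 1) ≤ ∫ u in (0 : ℝ)..b k, g (Y.y 1 + u) := by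
  obtain ⟨A, c, hc, hA, hA_nonneg, hA_neg, hA_big, hA_gap, hA_int⟩ :=
    exists_hump_series d b hb hb1 hstep
  have hanti : Antitone b := antitone_nat_of_succ_le fun k => by linarith [hstep k, hb k]
  have hy21 : Y.y 2 < Y.y 1 := Y.lt 2 (by norm_num) (by omega)
  have hy2s : Y.y (2 * s) ≤ Y.y 2 := Y.le_of_le (by omega) le_rfl
  have hT : 0 < 2 * Real.pi := Real.two_pi_pos
  have hper := Y.per
  set y₁ := Y.y 1
  set y₂ := Y.y 2
  set a := Y.y (2 * s)
  have hb0pos := hb 0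
  let γ : ContDiffBump ((y₁ + y₂) / 2) :=
    ⟨(y₁ - y₂) / 8, (y₁ - y₂) / 4, by linarith, by linarith⟩
  have hγ0 : ∀ x, x ≤ y₂ + (y₁ - y₂) / 4 ∨ y₁ - (y₁ - y₂) / 4 ≤ x → γ x = 0 := by
    intro x hx
    apply γ.zero_of_le_dist
    rw [Real.dist_eq]
    show (y₁ - y₂) / 4 ≤ _
    rcases hx with hx | hx
    · rw [abs_of_nonpos (by linarith)]; linarith
    · rw [abs_of_nonneg (by linarith)]; linarith
  have hγcd : ContDiff ℝ d γ := γ.contDiff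
  have hγint : 0 < ∫ x in a..a + 2 * Real.pi, γ x := by
    have hpos := γ.integral_pos (μ := MeasureTheory.volume)
    rwa [← intervalIntegral.integral_eq_integral_of_support_subset
      (a := a) (b := a + 2 * Real.pi)] at hpos
    intro x hx
    by_contra hx'
    refine hx (hγ0 x ?_)
    rw [Set.mem_Ioc, not_and_or] at hx'
    rcases hx' with h | h
    · left; linarith
    · right; linarith
  have hA' : ContDiff ℝ d fun x => A (x - y₁) := hA.comp (contDiff_id.sub contDiff_const)
  have hAint : 0 ≤ ∫ x in a..a + 2 * Real.pi, A (x - y₁) :=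
    intervalIntegral.integral_nonneg (by linarith) fun u _ => hA_nonneg _
  set m : ℝ := (∫ x in a..a + 2 * Real.pi, A (x - y₁)) / ∫ x in a..a + 2 * Real.pi, γ x
  have hm : 0 ≤ m := div_nonneg hAint hγint.le
  set g₀ : ℝ → ℝ := fun x => A (x - y₁) - m * γ x with hg₀
  have hg₀cd : ContDiff ℝ d g₀ := hA'.sub (contDiff_const.mul hγcd)
  have hg₀l : ∀ x ≤ y₂ + (y₁ - y₂) / 4, g₀ x = 0 := fun x hx => by
    simp only [hg₀]
    rw [hγ0 x (Or.inl hx), hA_neg _ (by linarith)]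
    ring
  have hg₀r : ∀ x, y₁ + b 0 ≤ x → g₀ x = 0 := fun x hx => by
    simp only [hg₀]
    rw [hγ0 x (Or.inr (by linarith)), hA_big _ (by linarith)]
    ring
  have hg₀A (u : ℝ) (hu : -(b 0 / 2) ≤ u) : g₀ (y₁ + u) = A u := by
    simp only [hg₀]
    rw [hγ0 _ (Or.inr (by linarith)), add_sub_cancel_left]
    ring
  have hgper : Function.Periodic (fun x => g₀ (toIcoMod hT a x)) (2 * Real.pi) := fun x => by
    simp only [toIcoMod_add_right]
  have hg_eq : ∀ x ∈ Set.Icc a (a + 2 * Real.pi), g₀ (toIcoMod hT a x) = g₀ x := by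
    intro x hx
    rcases hx.2.eq_or_lt with h | h
    · rw [h, toIcoMod_add_right, toIcoMod_apply_left, hg₀l a (by linarith),
        hg₀r _ (by linarith)]
    · rw [(toIcoMod_eq_self hT).2 ⟨hx.1, h⟩]
  have hgA (u : ℝ) (h1 : -(b 0 / 2) ≤ u) (h2 : u ≤ b 0) :
      g₀ (toIcoMod hT a (y₁ + u)) = A u := by
    rw [hg_eq _ ⟨by linarith, by linarith⟩, hg₀A u h1]
  refine ⟨fun x => g₀ (toIcoMod hT a x), c, hc,
    hg₀cd.comp_toIcoMod hT (l := y₂ + (y₁ - y₂) / 4) (u := y₁ + b 0) (by linarith) (by linarith)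
      hg₀l hg₀r, hgper, ?_, ?_, ?_, ?_, ?_⟩
  · have h := hgper.intervalIntegral_add_eq 0 a
    rw [zero_add] at h
    rw [h, intervalIntegral.integral_congr (g := g₀)]
    · simp only [hg₀]
      rw [intervalIntegral.integral_sub (hA'.continuous.intervalIntegrable _ _)
        ((hγcd.continuous.const_mul _ : Continuous fun x => m * γ x).intervalIntegrable _ _),
        intervalIntegral.integral_const_mul, div_mul_cancel₀ _ hγint.ne', sub_self]
    · rw [Set.uIcc_of_le (by linarith)]
      exact hg_eq
  · intro i hi1 hi2 x hx
    have hxa : x ∈ Set.Icc a (a + 2 * Real.pi) := by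
      have h1 := Y.le_of_le hi2 le_rfl
      have h2 := Y.le_of_le (Nat.zero_le (i - 1)) (by omega)
      exact ⟨by linarith [hx.1], by linarith [hx.2]⟩
    simp only [hg_eq x hxa]
    obtain rfl | rfl | hi3 : i = 1 ∨ i = 2 ∨ 3 ≤ i := by omega
    · have hx1 : y₁ < x := hx.1
      simp only [hg₀]
      rw [hγ0 x (Or.inr (by linarith))]
      simpa using hA_nonneg _
    · have hx1 : x < y₁ := hx.2
      simp only [hg₀]
      rw [hA_neg _ (by linarith)]
      simpa using mul_nonneg hm γ.nonneg
    · have h2 : Y.y (i - 1) ≤ y₂ := Y.le_of_le (by omega) (by omega)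
      rw [hg₀l x (by linarith [hx.2]), mul_zero]
  · intro k u hu h
    have hk := hanti (Nat.zero_le k)
    obtain ⟨hu1, hu2⟩ := abs_lt.1 hu
    simp only [hgA u (by linarith) (by linarith [hb k])]
    rcases h with h | h
    · exact hA_neg _ h.le
    · exact hA_gap k u h.le hu2.le
  · intro k u hu
    have hk := hanti (Nat.zero_le k)
    simp only [hgA u (by linarith [hu.1]) (by linarith [hu.2])]
    exact hA_nonneg u
  · intro k
    have hk := hanti (Nat.zero_le k)
    refine (hA_int k).trans_eq (intervalIntegral.integral_congr fun u hu => ?_)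
    rw [Set.uIcc_of_le (hb k).le] at hu
    exact (hgA u (by linarith [hu.1]) (by linarith [hu.2])).symm

lemma exists_rapid_sequence (P : ℕ → ℝ → ℕ → Prop) {b₀ : ℝ} (hb₀ : 0 < b₀)
    (hP : ∀ k b, 0 < b → b ≤ b₀ → ∀ᶠ n in Filter.atTop, P k b n) :
    ∃ (b : ℕ → ℝ) (n : ℕ → ℕ), b 0 = b₀ ∧ (∀ k, 0 < b k) ∧ (∀ k, b (k + 1) ≤ b k / 2) ∧
      (∀ k, 1 ≤ n k ∧ k ≤ n k) ∧ (∀ k, b (k + 1) = 1 / (40 * n k)) ∧ ∀ k, P k (b k) (n k) := by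
  have hex (k : ℕ) (b : ℝ) : ∃ N : ℕ, 0 < b → b ≤ b₀ →
      1 ≤ N ∧ k ≤ N ∧ 1 / (40 * (N : ℝ)) ≤ b / 2 ∧ P k b N := by
    by_cases hb : 0 < b ∧ b ≤ b₀
    · obtain ⟨N, h1, h2, h3, h4⟩ := ((Filter.eventually_ge_atTop 1).and
        ((Filter.eventually_ge_atTop k).and
          ((Filter.eventually_ge_atTop ⌈1 / b⌉₊).and (hP k b hb.1 hb.2)))).exists
      refine ⟨N, fun _ _ => ⟨h1, h2, ?_, h4⟩⟩
      have hN : 1 / b ≤ N := Nat.ceil_le.1 h3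
      have hN0 : (0 : ℝ) < N := by exact_mod_cast h1
      rw [div_le_iff₀ hb.1] at hN
      rw [div_le_iff₀ (by positivity)]
      linarith
    · exact ⟨0, fun h1 h2 => absurd ⟨h1, h2⟩ hb⟩
  choose N hN using hex
  set b : ℕ → ℝ := fun k => Nat.rec b₀ (fun k b => 1 / (40 * (N k b : ℝ))) k
  have hsucc (k : ℕ) : b (k + 1) = 1 / (40 * (N k (b k) : ℝ)) := rfl
  have hb (k : ℕ) : 0 < b k ∧ b k ≤ b₀ := by
    induction k with
    | zero => exact ⟨hb₀, le_rfl⟩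
    | succ k ih =>
      obtain ⟨h1, -, h3, -⟩ := hN k (b k) ih.1 ih.2
      have h0 : (0 : ℝ) < N k (b k) := by exact_mod_cast h1
      rw [hsucc]
      exact ⟨by positivity, by linarith [ih.1, ih.2]⟩
  have hN' (k : ℕ) := hN k (b k) (hb k).1 (hb k).2
  exact ⟨b, fun k => N k (b k), rfl, fun k => (hb k).1, fun k => (hN' k).2.2.1,
    fun k => ⟨(hN' k).1, (hN' k).2.1⟩, hsucc, fun k => (hN' k).2.2.2⟩

lemma SobolevW.of_contDiff {p : ℕ} (hp : 1 ≤ p) {f : ℝ → ℝ} (hf : ContDiff ℝ p f)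
    (hper : Function.Periodic f (2 * Real.pi)) (hb : ∀ x, |iteratedDeriv p f x| ≤ 2) :
    SobolevW p f := by
  have hc : Continuous (iteratedDeriv p f) := hf.continuous_iteratedDeriv p le_rfl
  refine ⟨hper, hf.of_le (by exact_mod_cast Nat.sub_le p 1), iteratedDeriv p f,
    fun a b => hc.intervalIntegrable a b, Filter.Eventually.of_forall hb, fun x => ?_⟩
  have hder : deriv (iteratedDeriv (p - 1) f) = iteratedDeriv p f := by
    rw [← iteratedDeriv_succ, Nat.sub_add_cancel hp]
  have hdiff : Differentiable ℝ (iteratedDeriv (p - 1) f) :=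
    hf.differentiable_iteratedDeriv (p - 1) (by exact_mod_cast Nat.sub_lt hp one_pos)
  rw [intervalIntegral.integral_deriv_eq_sub' _ hder (fun x _ => hdiff x) hc.continuousOn]
  ring

lemma Function.Periodic.exists_abs_le {T : ℝ} (hT : 0 < T) {f : ℝ → ℝ}
    (hper : Function.Periodic f T) (hf : Continuous f) : ∃ K, 0 ≤ K ∧ ∀ x, |f x| ≤ K := by
  obtain ⟨K, hK⟩ := (hper.isBounded_of_continuous hT.ne' hf).exists_norm_le
  exact ⟨K, (norm_nonneg _).trans (hK (f 0) ⟨0, rfl⟩), fun x => hK (f x) ⟨x, rfl⟩⟩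

/-- **Theorem 1.6.** Let `q ≥ 3`, `p ≥ q`, `s ∈ ℕ` and `Y_s ∈ 𝕐_s`. For each sequence
`{ε_n}` of positive numbers tending to infinity, there is a function `f ∈ Δ^(q)(Y_s) ∩ W^p`
such that `limsup_{n→∞} ε_n n^{p-q+2} E_n^(q)(f, Y_s) = ∞`. -/
theorem no_improved_rate_co_q_monotone (q p s : ℕ) (hq : 3 ≤ q) (hpq : q ≤ p) (hs : 1 ≤ s)
    (Y : PtsColl s) (ε : ℕ → ℝ) (hεpos : ∀ n : ℕ, 1 ≤ n → 0 < ε n)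
    (hεtop : Filter.Tendsto ε Filter.atTop Filter.atTop) :
    ∃ f : ℝ → ℝ, DeltaQ q s Y f ∧ SobolevW p f ∧
      ∀ M : ℝ, ∃ᶠ n in Filter.atTop,
        M < ε n * (n : ℝ) ^ (p - q + 2) * ErrCoQ q n s Y f := by
  obtain ⟨d, rfl⟩ : ∃ d, p = d + q := ⟨p - q, by omega⟩
  rw [Nat.add_sub_cancel]
  have hy21 : Y.y 2 < Y.y 1 := Y.lt 2 (by norm_num) (by omega)
  have hy10 : Y.y 1 < Y.y 0 := Y.lt 1 le_rfl (by omega)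
  set b₀ : ℝ := min 1 (min ((Y.y 0 - Y.y 1) / 2) ((Y.y 1 - Y.y 2) / 2))
  have hb₀ : 0 < b₀ := by
    refine lt_min one_pos (lt_min ?_ ?_) <;> linarith
  have hb₀1 : b₀ ≤ 1 := min_le_left _ _
  have hb₀0 : b₀ ≤ (Y.y 0 - Y.y 1) / 2 := (min_le_right _ _).trans (min_le_left _ _)
  have hb₀2 : b₀ ≤ (Y.y 1 - Y.y 2) / 2 := (min_le_right _ _).trans (min_le_right _ _)
  obtain ⟨b, n, hb0, hbpos, hstep, hn, hbn, hP⟩ := exists_rapid_sequence _ hb₀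
    fun k b hb hbb => eventually_lt_errCoQ q s d (by omega) hs Y ε hεtop (r := b / 2)
      (κ := (1 / 2) ^ (k + 1) / (k + 1)) k k (by positivity) (by linarith [Real.pi_gt_three])
      (by linarith) (by linarith) (by positivity)
  obtain ⟨g, c, hc, hg, hgper, hgint, hgsign, hgzero, hgnonneg, hgmass⟩ :=
    exists_periodic_hump_function d s hs Y b hbpos (by linarith) (by linarith) (by linarith) hstep
  obtain ⟨f, hf, hfper, hfg⟩ := hgper.exists_iteratedDeriv_eq Real.two_pi_pos q hg hgint
  obtain ⟨K, hK, hfK⟩ := (show Function.Periodic (iteratedDeriv (d + q) f) (2 * Real.pi) from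
    fun x => by
      have h := congrFun (iteratedDeriv_comp_add_const (d + q) f (2 * Real.pi)) x
      rwa [funext hfper, eq_comm] at h).exists_abs_le
      Real.two_pi_pos (hf.continuous_iteratedDeriv (d + q) le_rfl)
  obtain ⟨L, hL, hfL⟩ := hfper.exists_abs_le Real.two_pi_pos hf.continuous
  set σ : ℝ := 1 / (K + 1)
  have hσ : 0 < σ := by positivity
  have hF : ContDiff ℝ (d + q : ℕ) fun x => σ * f x := contDiff_const.mul hf
  have hFq : ContDiff ℝ q fun x => σ * f x := hF.of_le (by exact_mod_cast Nat.le_add_left q d)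
  have hFper : Function.Periodic (fun x => σ * f x) (2 * Real.pi) := fun x => by
    simp only [hfper x]
  have hFg (x : ℝ) : iteratedDeriv q (fun x => σ * f x) x = σ * g x := by
    rw [iteratedDeriv_const_mul_field, hfg]
  refine ⟨fun x => σ * f x, ⟨hF.continuous, hFper, fun i hi1 hi2 => ?_⟩, ?_, fun M => ?_⟩
  · refine QMonotoneOn.of_iteratedDeriv_nonneg (by omega) (contDiff_const.mul hFq) fun x hx => ?_
    rw [iteratedDeriv_const_mul_field, hFg, mul_left_comm]
    exact mul_nonneg hσ.le (hgsign i hi1 hi2 x hx)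
  · refine SobolevW.of_contDiff (by omega) hF hFper fun x => ?_
    rw [iteratedDeriv_const_mul_field, abs_mul, abs_of_pos hσ, div_mul_eq_mul_div, one_mul,
      div_le_iff₀ (by positivity)]
    linarith [hfK x]
  · have hlarge : ∀ᶠ k : ℕ in Filter.atTop,
        M ≤ k ∧ σ * L ≤ k ∧ 1 / (σ * c * (1 / 40) ^ (d + 1)) ≤ (k : ℝ) + 1 := by
      have ht := tendsto_natCast_atTop_atTop (R := ℝ)
      filter_upwards [ht.eventually_ge_atTop M, ht.eventually_ge_atTop (σ * L),
        ht.eventually_ge_atTop (1 / (σ * c * (1 / 40) ^ (d + 1)))] with k h1 h2 h3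
      exact ⟨h1, h2, h3.trans (by linarith)⟩
    refine Filter.frequently_atTop.2 fun N => ?_
    obtain ⟨k, hkN, hkM, hkL, hkc⟩ := ((Filter.eventually_ge_atTop N).and hlarge).exists
    refine ⟨n k, hkN.trans (hn k).2, hkM.trans_lt (hP k _ hFq ?_ ?_ ?_ ?_)⟩
    · intro x
      rw [abs_mul, abs_of_pos hσ]
      exact (mul_le_mul_of_nonneg_left (hfL x) hσ.le).trans hkL
    · intro u hu h
      rw [← hbn] at h
      rw [hFg, hgzero k u hu h, mul_zero]
    · intro u hu
      rw [← hbn] at hu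
      rw [hFg]
      exact mul_nonneg hσ.le (hgnonneg (k + 1) u hu)
    · simp only [hFg]
      rw [intervalIntegral.integral_const_mul, ← hbn]
      refine le_trans ?_ (mul_le_mul_of_nonneg_left (hgmass (k + 1)) hσ.le)
      have hn0 : (0 : ℝ) < n k := by exact_mod_cast (hn k).1
      rw [div_le_iff₀ (by positivity)] at hkc
      rw [hbn, div_div, div_le_iff₀ (by positivity)]
      calc (1 / 2 : ℝ) ^ (k + 1) = (1 / 2) ^ (k + 1) * 1 := (mul_one _).symm
        _ ≤ (1 / 2) ^ (k + 1) * ((k + 1) * (σ * c * (1 / 40) ^ (d + 1))) := by gcongr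
        _ = _ := by
          have e : (1 / (40 * (n k : ℝ))) ^ (d + 1) * (n k : ℝ) ^ (d + 1) = (1 / 40) ^ (d + 1) := by
            rw [← mul_pow]
            congr 1
            field_simp
          rw [← e]
          ring
end
end

section
/- For every n ∈ ℕ, every algebraic polynomial P of degree < n with real coefficients, and every x ∈ (−1, 1), one has |√(1−x²) · d/dx ( P(x) √(1−x²) )| ≤ n · max_{y ∈ [−1,1]} | P(y) √(1−y²) |. -/
noncomputable section

open Finset Complex

/-- The midpoints `(2k+1)π/(2n)`, the nodes of M. Riesz's interpolation formula. -/
def rieszNode (n k : ℕ) : ℝ := (2 * k + 1) * Real.pi / (2 * n)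

/-- The absolute values of the weights of M. Riesz's interpolation formula. -/
def rieszWeight (n k : ℕ) : ℝ := 1 / (n * (2 - 2 * Real.cos (rieszNode n k)))

theorem exp_rieszNode_pow {n : ℕ} (hn : 1 ≤ n) (k : ℕ) :
    exp (rieszNode n k * I) ^ n = (-1) ^ k * I := by
  have hn' : (n : ℂ) ≠ 0 := by exact_mod_cast (by omega : n ≠ 0)
  rw [← exp_nat_mul, show (n : ℂ) * (rieszNode n k * I) = k * (Real.pi * I) + Real.pi / 2 * I by
    simp only [rieszNode]; push_cast; field_simp, exp_add, exp_nat_mul, exp_pi_mul_I,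
    exp_pi_div_two_mul_I]

theorem exp_rieszNode_pow_two_mul {n : ℕ} (hn : 1 ≤ n) (k : ℕ) :
    exp (rieszNode n k * I) ^ (2 * n) = -1 := by
  rw [mul_comm 2 n, pow_mul, exp_rieszNode_pow hn, mul_pow, I_sq, ← pow_mul, mul_comm k 2, pow_mul]
  simp

theorem cos_rieszNode_lt_one {n : ℕ} (hn : 1 ≤ n) (k : ℕ) : Real.cos (rieszNode n k) < 1 := by
  refine lt_of_le_of_ne (Real.cos_le_one _) fun h => ?_
  have hs : Real.sin (rieszNode n k) = 0 := by
    have := Real.sin_sq_add_cos_sq (rieszNode n k)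
    rw [h] at this
    exact pow_eq_zero_iff two_ne_zero |>.1 (by linarith)
  have h1 : exp (rieszNode n k * I) = 1 := by
    rw [exp_mul_I, ← ofReal_cos, ← ofReal_sin, h, hs]; simp
  have := exp_rieszNode_pow_two_mul hn k
  rw [h1, one_pow] at this
  norm_num at this

theorem rieszWeight_nonneg {n : ℕ} (hn : 1 ≤ n) (k : ℕ) : 0 ≤ rieszWeight n k := by
  have := cos_rieszNode_lt_one hn k
  unfold rieszWeight
  have : 0 ≤ 2 - 2 * Real.cos (rieszNode n k) := by linarith
  positivity

theorem sum_exp_rieszNode_pow_eq_zero {n j : ℕ} (hj : 0 < j) (hjn : j < 2 * n) :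
    ∑ k ∈ range (2 * n), exp (rieszNode n k * I) ^ j = 0 := by
  have hn : (n : ℂ) ≠ 0 := by exact_mod_cast (by omega : n ≠ 0)
  have hω := isPrimitiveRoot_exp (2 * n) (by omega)
  set ω := exp (2 * Real.pi * I / (2 * n : ℕ)) with hω_eq
  have hz : ∀ k, exp (rieszNode n k * I) ^ j = exp (rieszNode n 0 * I) ^ j * (ω ^ j) ^ k := by
    intro k
    rw [← pow_mul, mul_comm j k, pow_mul, ← mul_pow, hω_eq, ← exp_nat_mul _ k, ← exp_add]
    congr 2
    simp only [rieszNode]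
    push_cast
    field_simp
    ring
  have hne : ω ^ j ≠ 1 := hω.pow_ne_one_of_pos_of_lt hj.ne' hjn
  rw [sum_congr rfl fun k _ => hz k, ← mul_sum, geom_sum_eq hne, ← pow_mul, mul_comm j, pow_mul,
    hω.pow_eq_one]
  simp

theorem rieszWeight_second_difference {n : ℕ} (hn : 1 ≤ n) (k j : ℕ) :
    n * (rieszWeight n k * (2 * exp (rieszNode n k * I) ^ (j + 1)
      - exp (rieszNode n k * I) ^ (j + 2) - exp (rieszNode n k * I) ^ j)) =
      exp (rieszNode n k * I) ^ (j + 1) := by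
  have hn' : (n : ℂ) ≠ 0 := by exact_mod_cast (by omega : n ≠ 0)
  have hc : (2 : ℂ) - 2 * Complex.cos (rieszNode n k) ≠ 0 := by
    have := cos_rieszNode_lt_one hn k
    rw [← ofReal_cos]
    exact_mod_cast (by linarith : 2 - 2 * Real.cos (rieszNode n k) ≠ 0)
  have hz : exp (rieszNode n k * I) ^ 2 + 1 =
      2 * Complex.cos (rieszNode n k) * exp (rieszNode n k * I) := by
    rw [two_cos, neg_mul, exp_neg]
    field_simp [exp_ne_zero]
  have hw : (rieszWeight n k : ℂ) * (n * (2 - 2 * Complex.cos (rieszNode n k))) = 1 := by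
    simp only [rieszWeight]
    push_cast
    exact one_div_mul_cancel (mul_ne_zero hn' hc)
  linear_combination (-n * rieszWeight n k * exp (rieszNode n k * I) ^ j) * hz +
    exp (rieszNode n k * I) ^ (j + 1) * hw

theorem sum_rieszWeight_mul_exp_pow {n : ℕ} (hn : 1 ≤ n) {j : ℕ} (hj : j ≤ 2 * n) :
    ∑ k ∈ range (2 * n), (rieszWeight n k : ℂ) * exp (rieszNode n k * I) ^ j = n - j := by
  have hn' : (n : ℂ) ≠ 0 := by exact_mod_cast (by omega : n ≠ 0)
  set A : ℕ → ℂ := fun j =>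
    ∑ k ∈ range (2 * n), (rieszWeight n k : ℂ) * exp (rieszNode n k * I) ^ j with hA
  have hdiff (j : ℕ) : n * (2 * A (j + 1) - A (j + 2) - A j) =
      ∑ k ∈ range (2 * n), exp (rieszNode n k * I) ^ (j + 1) := by
    rw [← sum_congr rfl fun k _ => rieszWeight_second_difference hn k j]
    simp only [hA, mul_sum, ← sum_sub_distrib]
    exact sum_congr rfl fun k _ => by ring
  have hperiod (j : ℕ) : A (2 * n + j) = -A j := by
    simp only [hA, pow_add, exp_rieszNode_pow_two_mul hn, ← sum_neg_distrib]
    exact sum_congr rfl fun k _ => by ring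
  have haff (j : ℕ) (hj : j + 1 ≤ 2 * n) :
      A j = A 0 + j * (A 1 - A 0) ∧ A (j + 1) = A 0 + (j + 1) * (A 1 - A 0) := by
    induction j with
    | zero => simp
    | succ j ih =>
      obtain ⟨h0, h1⟩ := ih (by omega)
      have h2 := hdiff j
      rw [sum_exp_rieszNode_pow_eq_zero (by omega) (by omega)] at h2
      have h3 := (mul_eq_zero.1 h2).resolve_left hn'
      push_cast
      exact ⟨h1, by linear_combination -h3 + 2 * h1 - h0⟩
  obtain ⟨m, hm⟩ : ∃ m, 2 * n = m + 1 := ⟨2 * n - 1, by omega⟩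
  have hm' : (m : ℂ) = 2 * n - 1 := by
    have : (2 * n : ℂ) = m + 1 := by exact_mod_cast hm
    linear_combination -this
  obtain ⟨hl0, hl1⟩ := haff m (by omega)
  have hp0 := hperiod 0
  have hp1 := hperiod 1
  have hd := hdiff m
  rw [← hm] at hd hl1
  rw [show m + 2 = 2 * n + 1 by omega, hp1, hl0] at hd
  rw [add_zero] at hp0
  simp only [exp_rieszNode_pow_two_mul hn, sum_const, card_range, nsmul_eq_mul, hp0, hm'] at hd hl1
  push_cast at hd
  have hd' : 2 * -A 0 - -A 1 - (A 0 + (2 * n - 1) * (A 1 - A 0)) = -2 :=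
    mul_left_cancel₀ hn' (by linear_combination hd)
  have hb : A 1 - A 0 = -1 := by linear_combination hd' / 2 - hl1 / 2
  have ha : A 0 = n := by rw [hb] at hl1; linear_combination -hl1 / 2
  change A j = n - j
  rcases j with _ | j
  · simp [ha]
  · rw [(haff j hj).2, hb, ha]
    push_cast
    ring

theorem sum_rieszWeight {n : ℕ} (hn : 1 ≤ n) : ∑ k ∈ range (2 * n), rieszWeight n k = n := by
  have := sum_rieszWeight_mul_exp_pow hn (Nat.zero_le (2 * n))
  simp only [pow_zero, mul_one, Nat.cast_zero, sub_zero] at this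
  exact_mod_cast this

/-- M. Riesz's interpolation formula for the derivative of a trigonometric polynomial. -/
theorem hasDerivAt_riesz {n : ℕ} (hn : 1 ≤ n) {F : ℝ → ℂ} (q : ℕ → ℂ)
    (hF : ∀ θ : ℝ, F θ = ∑ j ∈ range (2 * n + 1), q j * exp ((j - n) * I * θ)) (θ : ℝ) :
    HasDerivAt F
      (∑ k ∈ range (2 * n), (-1) ^ k * (rieszWeight n k : ℂ) * F (θ + rieszNode n k)) θ := by
  have hd : HasDerivAt F
      (∑ j ∈ range (2 * n + 1), q j * (exp ((j - n) * I * θ) * ((j - n) * I * 1))) θ := by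
    rw [funext hF]
    refine HasDerivAt.fun_sum fun j _ => HasDerivAt.const_mul _ ?_
    exact (((hasDerivAt_id (θ : ℂ)).const_mul ((j - n) * I : ℂ)).cexp).comp_ofReal
  convert hd using 1
  simp only [hF, mul_sum]
  rw [sum_comm]
  refine sum_congr rfl fun j hj => ?_
  have hj' : j ≤ 2 * n := by simpa [Nat.lt_succ_iff] using hj
  have hterm (k : ℕ) : (-1) ^ k * (rieszWeight n k : ℂ) *
      (q j * exp ((j - n) * I * ((θ + rieszNode n k : ℝ) : ℂ))) =
      q j * exp ((j - n) * I * θ) * (-I) *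
        (rieszWeight n k * exp (rieszNode n k * I) ^ j) := by
    have h1 : exp ((j - n) * I * ((θ + rieszNode n k : ℝ) : ℂ)) * exp (rieszNode n k * I) ^ n =
        exp ((j - n) * I * θ) * exp (rieszNode n k * I) ^ j := by
      rw [← exp_nat_mul, ← exp_nat_mul, ← exp_add, ← exp_add]
      congr 1
      push_cast
      ring
    rw [exp_rieszNode_pow hn] at h1
    linear_combination (-I * q j * rieszWeight n k) * h1 +
      ((-1) ^ k * (rieszWeight n k : ℂ) *
        (q j * exp ((j - n) * I * ((θ + rieszNode n k : ℝ) : ℂ)))) * I_sq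
  rw [sum_congr rfl fun k _ => hterm k, ← mul_sum, sum_rieszWeight_mul_exp_pow hn hj']
  ring

/-- **Bernstein's inequality** for trigonometric polynomials. -/
theorem norm_deriv_le_of_trigonometric {n : ℕ} (hn : 1 ≤ n) {F : ℝ → ℂ} (q : ℕ → ℂ)
    (hF : ∀ θ : ℝ, F θ = ∑ j ∈ range (2 * n + 1), q j * exp ((j - n) * I * θ))
    {M : ℝ} (hM : ∀ θ, ‖F θ‖ ≤ M) (θ : ℝ) : ‖deriv F θ‖ ≤ n * M := by
  rw [(hasDerivAt_riesz hn q hF θ).deriv, ← sum_rieszWeight hn, sum_mul]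
  refine norm_sum_le_of_le _ fun k _ => ?_
  have h0 := rieszWeight_nonneg hn k
  rw [norm_mul, norm_mul, norm_pow, norm_neg, norm_one, one_pow, one_mul, norm_real,
    Real.norm_of_nonneg h0]
  exact mul_le_mul_of_nonneg_left (hM _) h0

theorem exists_trigonometric_expansion {n : ℕ} {P : Polynomial ℝ} (hP : P.degree < n) :
    ∃ q : ℕ → ℂ, ∀ θ : ℝ, ((P.eval (Real.cos θ) * Real.sin θ : ℝ) : ℂ) =
      ∑ j ∈ range (2 * n + 1), q j * exp ((j - n) * I * θ) := by
  let Q : Polynomial ℂ := ∑ k ∈ range n, Polynomial.C ((P.coeff k : ℂ) * (-I / 2) * (1 / 2) ^ k) *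
    (Polynomial.X ^ 2 - 1) * (Polynomial.X ^ 2 + 1) ^ k * Polynomial.X ^ (n - 1 - k)
  have hQ : Q.natDegree < 2 * n + 1 := by
    refine Nat.lt_succ_of_le (Polynomial.natDegree_sum_le_of_forall_le _ _ fun k hk => ?_)
    have hk' := mem_range.1 hk
    have : (Polynomial.C ((P.coeff k : ℂ) * (-I / 2) * (1 / 2) ^ k) *
      (Polynomial.X ^ 2 - 1) * (Polynomial.X ^ 2 + 1) ^ k *
        Polynomial.X ^ (n - 1 - k)).natDegree ≤ 0 + 2 + k * 2 + (n - 1 - k) := by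
      compute_degree
    omega
  refine ⟨Q.coeff, fun θ => ?_⟩
  set w := exp (θ * I) with hw
  have hw0 : w ≠ 0 := exp_ne_zero _
  have hterm (j : ℕ) : Q.coeff j * exp ((j - n) * I * θ) * w ^ n = Q.coeff j * w ^ j := by
    rw [mul_assoc, hw, ← exp_nat_mul, ← exp_nat_mul, ← exp_add]
    congr 1
    congr 1
    ring
  refine mul_right_cancel₀ (pow_ne_zero n hw0) ?_
  rw [sum_mul, sum_congr rfl fun j _ => hterm j, ← Polynomial.eval_eq_sum_range' hQ,
    Polynomial.eval_finsetSum]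
  have hPe : P.eval (Real.cos θ) = ∑ k ∈ range n, P.coeff k * Real.cos θ ^ k := by
    rcases eq_or_ne P 0 with rfl | hP0
    · simp
    · exact Polynomial.eval_eq_sum_range' ((Polynomial.natDegree_lt_iff_degree_lt hP0).2 hP) _
  rw [hPe]
  push_cast
  rw [sum_mul, sum_mul]
  refine sum_congr rfl fun k hk => ?_
  have hcos : 1 / 2 * (w ^ 2 + 1) = Complex.cos θ * w := by
    rw [Complex.cos, neg_mul, exp_neg, ← hw]
    field_simp
  have hsin : -I / 2 * (w ^ 2 - 1) = Complex.sin θ * w := by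
    rw [Complex.sin, neg_mul, exp_neg, ← hw]
    field_simp
    ring
  have hn : w ^ n = w * w ^ k * w ^ (n - 1 - k) := by
    rw [← pow_succ', ← pow_add]
    congr 1
    have := mem_range.1 hk
    omega
  simp only [Polynomial.eval_mul, Polynomial.eval_pow, Polynomial.eval_sub, Polynomial.eval_add,
    Polynomial.eval_X, Polynomial.eval_one, Polynomial.eval_C]
  calc _ = (P.coeff k : ℂ) * (Complex.sin θ * w) * (Complex.cos θ * w) ^ k * w ^ (n - 1 - k) := by
        rw [hn, mul_pow]; ring
    _ = _ := by rw [← hsin, ← hcos, mul_pow]; ring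

/-- **Bernstein-de la Vallée-Poussin type inequality for `P(x)√(1-x²)`.** For every algebraic
polynomial `P` of degree `< n` and every `x ∈ (-1,1)`,
`|√(1-x²) (P(x)√(1-x²))'| ≤ n max_{y ∈ [-1,1]} |P(y)√(1-y²)|`. -/
theorem bernstein_sqrt_weighted (n : ℕ) (hn : 1 ≤ n) (P : Polynomial ℝ)
    (hP : P.degree < (n : ℕ)) (x : ℝ) (hx : x ∈ Set.Ioo (-1 : ℝ) 1) :
    |Real.sqrt (1 - x ^ 2) * deriv (fun y => P.eval y * Real.sqrt (1 - y ^ 2)) x| ≤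
      n * sSup ((fun y => |P.eval y * Real.sqrt (1 - y ^ 2)|) '' Set.Icc (-1 : ℝ) 1) := by
  set M := sSup ((fun y => |P.eval y * Real.sqrt (1 - y ^ 2)|) '' Set.Icc (-1 : ℝ) 1)
  have hbdd : BddAbove ((fun y => |P.eval y * Real.sqrt (1 - y ^ 2)|) '' Set.Icc (-1 : ℝ) 1) :=
    (isCompact_Icc.image (by fun_prop)).bddAbove
  set f : ℝ → ℝ := fun θ => P.eval (Real.cos θ) * Real.sin θ with hf
  have hfM (θ : ℝ) : ‖(f θ : ℂ)‖ ≤ M := by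
    refine le_csSup hbdd ⟨Real.cos θ, Real.cos_mem_Icc θ, ?_⟩
    simp only [hf]
    rw [norm_real, Real.norm_eq_abs, ← Real.abs_sin_eq_sqrt_one_sub_cos_sq, abs_mul, abs_mul,
      abs_abs]
  obtain ⟨q, hq⟩ := exists_trigonometric_expansion hP
  have hfd : Differentiable ℝ f := by fun_prop
  have hder := (hfd (Real.arccos x)).hasDerivAt
  have hbern := norm_deriv_le_of_trigonometric hn q hq hfM (Real.arccos x)
  rw [hder.ofReal_comp.deriv, norm_real, Real.norm_eq_abs] at hbern
  have hg : HasDerivAt (fun y => P.eval y * Real.sqrt (1 - y ^ 2))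
      (deriv f (Real.arccos x) * -(1 / Real.sqrt (1 - x ^ 2))) x := by
    refine (hder.comp x (Real.hasDerivAt_arccos hx.1.ne' hx.2.ne)).congr_of_eventuallyEq ?_
    filter_upwards [isOpen_Ioo.mem_nhds hx] with y hy
    simp only [hf, Function.comp_apply, Real.cos_arccos hy.1.le hy.2.le, Real.sin_arccos]
  have hpos : 0 < Real.sqrt (1 - x ^ 2) := Real.sqrt_pos.2 (by nlinarith [hx.1, hx.2])
  rw [hg.deriv, show Real.sqrt (1 - x ^ 2) * (deriv f (Real.arccos x) *
    -(1 / Real.sqrt (1 - x ^ 2))) = -deriv f (Real.arccos x) by field_simp, abs_neg]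
  exact hbern
end
end
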